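/- arXiv:math/0403049 — 2 statements merged into one kernel-verified Lean document; each statement's English description precedes it below -/
import Mathlib

section
/- Weak type (1,1) of the maximal convolution operator for non-radial kernels: for every κ > 0, let φ ∈ L¹(μ_κ) and suppose there exists ψ(x) = ψ₀(|x|) ∈ L¹(μ_κ), with ψ₀ : [0,∞) → [0,∞) differentiable, ψ₀(r) → 0 as r → ∞, ∫_0^∞ r^{2κ+1} |ψ₀'(r)| dr < ∞, such that |φ(x)| ≤ ψ(x) for all x. Then there is a constant c such that for every f ∈ L¹(μ_κ) and every a > 0, μ_κ({x ∈ ℝ : sup_{ε>0} |(f *_κ φ_ε)(x)| > a}) ≤ (c/a) ‖f‖_{L¹(μ_κ)}. -/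
open MeasureTheory Real Filter Topology

/-- The weighted measure `dμ_κ(t) = |t|^{2κ} dt` on `ℝ`. -/
noncomputable def mu (κ : ℝ) : Measure ℝ :=
  MeasureTheory.volume.withDensity (fun t => ENNReal.ofReal (|t| ^ (2 * κ)))

/-- The normalizing constant `b_κ = Γ(κ+1/2)/(√π Γ(κ))`. -/
noncomputable def bk (κ : ℝ) : ℝ := Real.Gamma (κ + 1 / 2) / (Real.sqrt π * Real.Gamma κ)

/-- The density `Φ_κ(u) = b_κ (1+u)(1-u²)^{κ-1}`. -/
noncomputable def Phi (κ u : ℝ) : ℝ := bk κ * (1 + u) * (1 - u ^ 2) ^ (κ - 1)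

/-- The generalized (Dunkl) translation operator `τ_s` for the group `ℤ₂` on `ℝ`. -/
noncomputable def tau (κ s : ℝ) (f : ℝ → ℂ) (t : ℝ) : ℂ :=
  (1 / 2 : ℂ) * ∫ u in Set.Ioo (-1 : ℝ) 1,
    (f (Real.sqrt (t ^ 2 + s ^ 2 - 2 * s * t * u)) *
        ((1 + (t - s) / Real.sqrt (t ^ 2 + s ^ 2 - 2 * s * t * u) : ℝ) : ℂ) +
      f (-Real.sqrt (t ^ 2 + s ^ 2 - 2 * s * t * u)) *
        ((1 - (t - s) / Real.sqrt (t ^ 2 + s ^ 2 - 2 * s * t * u) : ℝ) : ℂ)) *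
    ((Phi κ u : ℝ) : ℂ)

/-- The generalized convolution `(f *_κ g)(x) = ∫ f(y) τ_x g^∨(y) dμ_κ(y)`. -/
noncomputable def conv (κ : ℝ) (f g : ℝ → ℂ) (x : ℝ) : ℂ :=
  ∫ y, f y * tau κ x (fun z => g (-z)) y ∂(mu κ)

/-- The dilation `φ_ε(x) = ε^{-(2κ+1)} φ(x/ε)`. -/
noncomputable def dil (κ : ℝ) (φ : ℝ → ℂ) (ε x : ℝ) : ℂ :=
  ((ε ^ (-(2 * κ + 1)) : ℝ) : ℂ) * φ (x / ε)

open scoped ENNReal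

theorem exists_besicovitch_weak_type : ∃ N : ℕ, ∀ (μ ν : Measure ℝ) (l : ℝ≥0∞),
    l * μ {x | ∃ r : ℝ, 0 < r ∧ l * μ (Metric.closedBall x r) < ν (Metric.closedBall x r)} ≤
      N * ν Set.univ := by
  obtain ⟨N, τ, hτ, hN⟩ := HasBesicovitchCovering.no_satelliteConfig (α := ℝ)
  refine ⟨N, fun μ ν l => ?_⟩
  set E : ℕ → Set ℝ := fun n => {x | ∃ r : ℝ, 0 < r ∧ r ≤ n ∧
    l * μ (Metric.closedBall x r) < ν (Metric.closedBall x r)} with hE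
  have hEmono : Monotone E := by
    rintro m n hmn x ⟨r, h0, h1, h2⟩
    exact ⟨r, h0, h1.trans (by exact_mod_cast hmn), h2⟩
  have hEunion : {x | ∃ r : ℝ, 0 < r ∧ l * μ (Metric.closedBall x r) < ν (Metric.closedBall x r)}
      = ⋃ n, E n := by
    ext x
    simp only [Set.mem_ofPred_eq, Set.mem_iUnion, hE]
    constructor
    · rintro ⟨r, h0, h2⟩
      obtain ⟨n, hn⟩ := exists_nat_ge r
      exact ⟨n, r, h0, hn, h2⟩
    · rintro ⟨n, r, h0, -, h2⟩
      exact ⟨r, h0, h2⟩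
  rw [hEunion, hEmono.measure_iUnion, ENNReal.mul_iSup]
  refine iSup_le fun n => ?_
  choose ρ hρ0 hρn hρ using fun x : E n => x.2
  let q : Besicovitch.BallPackage (E n) ℝ :=
    { c := fun x => x, r := ρ, rpos := hρ0, r_bound := n, r_le := hρn }
  obtain ⟨s, hs, hcov⟩ := Besicovitch.exist_disjoint_covering_families hτ hN q
  have hcount : ∀ i, (s i).Countable := fun i =>
    (hs i).countable_of_nonempty_interior fun j _ => by
      refine ⟨q.c j, Metric.ball_subset_interior_closedBall (Metric.mem_ball_self (hρ0 j))⟩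
  have hsub : E n ⊆ ⋃ i, ⋃ j ∈ s i, Metric.closedBall (q.c j) (q.r j) := by
    intro x hx
    have := hcov ⟨⟨x, hx⟩, rfl⟩
    simp only [Set.mem_iUnion] at this ⊢
    obtain ⟨i, j, hj, h⟩ := this
    exact ⟨i, j, hj, Metric.ball_subset_closedBall h⟩
  calc l * μ (E n) ≤ l * ∑ i, ∑' j : s i, μ (Metric.closedBall (q.c j) (q.r j)) := by
        gcongr
        refine (measure_mono hsub).trans ((measure_iUnion_fintype_le _ _).trans ?_)
        gcongr with i
        exact measure_biUnion_le _ (hcount i) _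
    _ = ∑ i, ∑' j : s i, l * μ (Metric.closedBall (q.c j) (q.r j)) := by
        simp_rw [Finset.mul_sum, ENNReal.tsum_mul_left]
    _ ≤ ∑ i : Fin N, ν Set.univ := by
        gcongr with i
        calc ∑' j : s i, l * μ (Metric.closedBall (q.c j) (q.r j))
            ≤ ∑' j : s i, ν (Metric.closedBall (q.c j) (q.r j)) := by
              gcongr with j
              exact (hρ j).le
          _ = ν (⋃ j ∈ s i, Metric.closedBall (q.c j) (q.r j)) :=
              (measure_biUnion (hcount i) (hs i) fun _ _ => measurableSet_closedBall).symm
          _ ≤ ν Set.univ := measure_mono (Set.subset_univ _)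
    _ = N * ν Set.univ := by simp

theorem lintegral_Ioc_rpow {κ : ℝ} (hκ : 0 < κ) {δ : ℝ} (hδ : 0 ≤ δ) :
    ∫⁻ v in Set.Ioc 0 δ, ENNReal.ofReal (v ^ (κ - 1)) = ENNReal.ofReal (δ ^ κ / κ) := by
  have hi : IntervalIntegrable (fun v : ℝ => v ^ (κ - 1)) volume 0 δ :=
    intervalIntegral.intervalIntegrable_rpow' (by linarith)
  rw [← ofReal_integral_eq_lintegral_ofReal]
  · rw [← intervalIntegral.integral_of_le hδ, integral_rpow (Or.inl (by linarith))]
    simp [hκ.ne']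
  · exact (intervalIntegrable_iff_integrableOn_Ioc_of_le hδ).1 hi
  · filter_upwards [ae_restrict_mem measurableSet_Ioc] with v hv
    exact rpow_nonneg hv.1.le _

theorem one_sub_sq_rpow_le {κ : ℝ} (hκ : 0 < κ) {u : ℝ} (hu : |u| < 1) :
    (1 - u ^ 2) ^ (κ - 1) ≤ 2 ^ κ * (1 - |u|) ^ (κ - 1) := by
  have h0 := abs_nonneg u
  have : 1 - u ^ 2 = (1 + |u|) * (1 - |u|) := by rw [← sq_abs]; ring
  rw [this, mul_rpow (by linarith) (by linarith)]
  have h1 : 0 ≤ (1 - |u|) ^ (κ - 1) := rpow_nonneg (by linarith) _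
  gcongr
  calc (1 + |u|) ^ (κ - 1) ≤ (1 + |u|) ^ κ :=
        rpow_le_rpow_of_exponent_le (by linarith) (by linarith)
    _ ≤ 2 ^ κ := rpow_le_rpow (by linarith) (by linarith) hκ.le

theorem lintegral_one_sub_sq_rpow_le {κ : ℝ} (hκ : 0 < κ) {δ : ℝ} (hδ : 0 ≤ δ) :
    ∫⁻ u in Set.Ioo (-1 : ℝ) 1,
      {u : ℝ | 1 - |u| ≤ δ}.indicator (fun u => ENNReal.ofReal ((1 - u ^ 2) ^ (κ - 1))) u ≤
      ENNReal.ofReal (2 ^ (κ + 1) / κ * δ ^ κ) := by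
  set g : ℝ → ℝ≥0∞ := (Set.Ioc 0 δ).indicator
    (fun v => ENNReal.ofReal (2 ^ κ) * ENNReal.ofReal (v ^ (κ - 1))) with hg
  have hgm : Measurable g := by
    refine Measurable.indicator (by fun_prop) measurableSet_Ioc
  have hgi : ∫⁻ v, g v = ENNReal.ofReal (2 ^ κ * (δ ^ κ / κ)) := by
    rw [hg, lintegral_indicator measurableSet_Ioc, lintegral_const_mul _ (by fun_prop),
      lintegral_Ioc_rpow hκ hδ, ENNReal.ofReal_mul (by positivity)]
  have key : ∀ u, |u| < 1 → 1 - |u| ≤ δ →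
      ENNReal.ofReal ((1 - u ^ 2) ^ (κ - 1)) ≤ g (1 - |u|) := by
    intro u hu hd
    rw [hg, Set.indicator_of_mem (Set.mem_Ioc.2 ⟨by linarith, hd⟩), ← ENNReal.ofReal_mul (by positivity)]
    exact ENNReal.ofReal_le_ofReal (one_sub_sq_rpow_le hκ hu)
  calc _ ≤ ∫⁻ u in Set.Ioo (-1 : ℝ) 1, (g (1 - u) + g (1 + u)) := by
        refine setLIntegral_mono (by fun_prop) fun u hu => ?_
        rw [Set.indicator_apply]
        split_ifs with hd
        swap
        · exact zero_le
        refine (key u (abs_lt.2 hu) hd).trans ?_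
        rcases abs_cases u with h | h <;> rw [h.1]
        · exact le_self_add
        · rw [sub_neg_eq_add]; exact le_add_self
    _ ≤ ∫⁻ u, (g (1 - u) + g (1 + u)) := setLIntegral_le_lintegral _ _
    _ = (∫⁻ u, g u) + ∫⁻ u, g u := by
        rw [lintegral_add_left (by fun_prop), lintegral_sub_left_eq_self,
          lintegral_add_left_eq_self]
    _ = _ := by
        rw [hgi, ← ENNReal.ofReal_add (by positivity) (by positivity),
          rpow_add (by norm_num), rpow_one]
        congr 1; ring

theorem sq_abs_sub_abs_le (x y u : ℝ) :
    (|y| - |x|) ^ 2 + 2 * (|x| * |y|) * (1 - |u|) ≤ y ^ 2 + x ^ 2 - 2 * x * y * u := by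
  have h1 : x * y * u ≤ |x| * |y| * |u| := by
    rw [← abs_mul, ← abs_mul]; exact le_abs_self _
  nlinarith [sq_abs x, sq_abs y]

theorem lintegral_sqrt_lt_le {κ : ℝ} (hκ : 0 < κ) (x y : ℝ) {r : ℝ} (hr : 0 < r) :
    ∫⁻ u in Set.Ioo (-1 : ℝ) 1, {u : ℝ | √(y ^ 2 + x ^ 2 - 2 * x * y * u) < r}.indicator
        (fun u => ENNReal.ofReal ((1 - u ^ 2) ^ (κ - 1))) u ≤
      {y : ℝ | abs (|x| - |y|) ≤ r}.indicator
        (fun _ => ENNReal.ofReal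
          (2 ^ (κ + 1) / κ * 9 ^ κ * (r ^ (2 * κ) / (|x| + r) ^ (2 * κ)))) y := by
  have hx := abs_nonneg x
  have hy := abs_nonneg y
  have key : ∀ u, √(y ^ 2 + x ^ 2 - 2 * x * y * u) < r →
      (|y| - |x|) ^ 2 + 2 * (|x| * |y|) * (1 - |u|) < r ^ 2 := fun u h =>
    (sq_abs_sub_abs_le x y u).trans_lt ((sqrt_lt' hr).1 h)
  by_cases hxy : abs (|x| - |y|) ≤ r
  · rw [Set.indicator_of_mem (by exact hxy)]
    obtain ⟨δ, hδ, hδx, hδu⟩ : ∃ δ : ℝ, 0 ≤ δ ∧ δ * (|x| + r) ^ 2 ≤ 9 * r ^ 2 ∧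
        ∀ u ∈ Set.Ioo (-1 : ℝ) 1, √(y ^ 2 + x ^ 2 - 2 * x * y * u) < r → 1 - |u| ≤ δ := by
      rcases le_or_gt |x| (2 * r) with h | h
      · refine ⟨1, zero_le_one, by nlinarith, fun u _ _ => by linarith [abs_nonneg u]⟩
      · have hyx : |x| / 2 ≤ |y| := by linarith [(abs_le.1 hxy).2]
        have hx0 : 0 < |x| := by linarith
        refine ⟨r ^ 2 / |x| ^ 2, by positivity, ?_, fun u hu hr' => ?_⟩
        · rw [div_mul_eq_mul_div, div_le_iff₀ (by positivity)]
          have : (|x| + r) ^ 2 ≤ 9 * |x| ^ 2 := by nlinarith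
          nlinarith [sq_nonneg r]
        · rw [le_div_iff₀ (by positivity)]
          have hu' : 0 ≤ 1 - |u| := by linarith [abs_lt.2 hu]
          have := key u hr'
          nlinarith [sq_nonneg (|y| - |x|), mul_nonneg (mul_nonneg hx0.le hu') (sub_nonneg.2 hyx)]
    refine (setLIntegral_mono' measurableSet_Ioo fun u hu => ?_).trans
      ((lintegral_one_sub_sq_rpow_le hκ hδ).trans (ENNReal.ofReal_le_ofReal ?_))
    · refine Set.indicator_apply_le fun h => ?_
      rw [Set.indicator_of_mem (by exact hδu u hu h)]
    · rw [mul_assoc]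
      gcongr
      rw [← mul_div_assoc, le_div_iff₀ (by positivity), rpow_mul (by positivity),
        rpow_mul hr.le, ← mul_rpow (by positivity) (by positivity),
        ← mul_rpow (by positivity) (by positivity), rpow_two, rpow_two]
      exact rpow_le_rpow (by positivity) hδx hκ.le
  · rw [Set.indicator_of_notMem (by exact hxy)]
    refine (setLIntegral_mono' measurableSet_Ioo (g := fun _ => 0) fun u hu => ?_).trans
      (by simp)
    rw [Set.indicator_apply]
    split_ifs with h
    swap
    · exact zero_le
    refine absurd ?_ hxy
    have hu' : 0 ≤ 1 - |u| := by linarith [abs_lt.2 hu]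
    have := key u h
    rw [abs_sub_comm]
    refine abs_le_of_sq_le_sq ?_ hr.le
    nlinarith [mul_nonneg (mul_nonneg hx hy) hu']

theorem bk_pos {κ : ℝ} (hκ : 0 < κ) : 0 < bk κ :=
  div_pos (Gamma_pos_of_pos (by linarith))
    (mul_pos (sqrt_pos.2 pi_pos) (Gamma_pos_of_pos hκ))

theorem mu_closedBall_le {κ : ℝ} (hκ : 0 < κ) (x : ℝ) {r : ℝ} (hr : 0 < r) :
    mu κ (Metric.closedBall x r) ≤ ENNReal.ofReal (2 * r * (|x| + r) ^ (2 * κ)) := by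
  rw [mu, withDensity_apply _ measurableSet_closedBall]
  calc _ ≤ ∫⁻ _ in Metric.closedBall x r, ENNReal.ofReal ((|x| + r) ^ (2 * κ)) := by
        refine setLIntegral_mono measurable_const fun y hy => ENNReal.ofReal_le_ofReal ?_
        have h1 : |y - x| ≤ r := by simpa [Real.dist_eq] using hy
        have h2 : |y| ≤ |x| + r := by linarith [abs_sub_abs_le_abs_sub y x]
        exact rpow_le_rpow (abs_nonneg y) h2 (by positivity)
    _ = _ := by
        rw [setLIntegral_const, Real.volume_closedBall, ← ENNReal.ofReal_mul (by positivity),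
          mul_comm]

theorem ofReal_le_lintegral_enorm_deriv {κ : ℝ} (hκ : 0 < κ) {ψ₀ : ℝ → ℝ}
    (hdiff : DifferentiableOn ℝ ψ₀ (Set.Ici 0)) (hlim : Tendsto ψ₀ atTop (𝓝 0))
    (hint : IntegrableOn (fun r => r ^ (2 * κ + 1) * |deriv ψ₀ r|) (Set.Ioi 0))
    {r : ℝ} (hr : 0 < r) :
    ENNReal.ofReal (ψ₀ r) ≤
      ∫⁻ R in Set.Ioi 0, (Set.Ioi r).indicator (fun R => ‖deriv ψ₀ R‖ₑ) R := by
  have hd : ∀ R ∈ Set.Ici r, HasDerivAt ψ₀ (deriv ψ₀ R) R := fun R hR =>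
    (hdiff.differentiableAt (Ici_mem_nhds (hr.trans_le hR))).hasDerivAt
  have hi : IntegrableOn (deriv ψ₀) (Set.Ioi r) := by
    have h1 := (hint.mono_set (Set.Ioi_subset_Ioi hr.le)).const_mul (r ^ (2 * κ + 1))⁻¹
    refine h1.mono' (measurable_deriv ψ₀).aestronglyMeasurable ?_
    filter_upwards [ae_restrict_mem measurableSet_Ioi] with R hR
    have h2 : r ^ (2 * κ + 1) ≤ R ^ (2 * κ + 1) :=
      rpow_le_rpow hr.le (le_of_lt hR) (by linarith)
    rw [norm_eq_abs, inv_mul_eq_div, le_div_iff₀ (by positivity), mul_comm]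
    gcongr
  have h3 := integral_Ioi_of_hasDerivAt_of_tendsto' hd hi hlim
  rw [lintegral_indicator measurableSet_Ioi, Measure.restrict_restrict measurableSet_Ioi,
    Set.inter_eq_left.2 (Set.Ioi_subset_Ioi hr.le)]
  calc ENNReal.ofReal (ψ₀ r) ≤ ‖∫ R in Set.Ioi r, deriv ψ₀ R‖ₑ := by
        rw [h3, ← ofReal_norm]
        refine ENNReal.ofReal_le_ofReal ?_
        rw [zero_sub, norm_neg]
        exact le_abs_self _
    _ ≤ _ := enorm_integral_le_lintegral_enorm _

/-- The possibly negative weights of the translation are absorbed by the factor `1 + u` of the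
density. -/
theorem translation_weight_le {x y u : ℝ} (hu : u ∈ Set.Ioo (-1 : ℝ) 1) :
    (|1 + (y - x) / √(y ^ 2 + x ^ 2 - 2 * x * y * u)| +
      |1 - (y - x) / √(y ^ 2 + x ^ 2 - 2 * x * y * u)|) * (1 + u) ≤ 8 := by
  obtain ⟨hu1, hu2⟩ := hu
  set ρ := √(y ^ 2 + x ^ 2 - 2 * x * y * u) with hρ
  set q := (y - x) / ρ with hq
  have h1 : q ^ 2 * (1 + u) ≤ 2 := by
    have hρ0 : 0 ≤ ρ := sqrt_nonneg _
    rcases hρ0.eq_or_lt with h0 | h0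
    · rw [hq, ← h0]; norm_num
    · have h2 : ρ ^ 2 = y ^ 2 + x ^ 2 - 2 * x * y * u := sq_sqrt (sqrt_pos.1 h0).le
      rw [hq, div_pow, div_mul_eq_mul_div, div_le_iff₀ (by positivity), h2]
      nlinarith [mul_nonneg (sq_nonneg (y + x)) (by linarith : (0 : ℝ) ≤ 1 - u)]
  have h2 : |q| * (1 + u) ≤ 2 := by
    refine (sq_le_sq₀ (mul_nonneg (abs_nonneg _) (by linarith)) (by norm_num)).1 ?_
    rw [mul_pow, sq_abs]
    nlinarith
  have h3 : |1 + q| ≤ 1 + |q| := (abs_add_le _ _).trans (by simp)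
  have h4 : |1 - q| ≤ 1 + |q| := (abs_sub _ _).trans (by simp)
  nlinarith

theorem enorm_tau_le {κ : ℝ} (hκ : 0 < κ) {x : ℝ} (hx : x ≠ 0) (y : ℝ) {g : ℝ → ℂ}
    {G : ℝ → ℝ≥0∞} (hg : ∀ z, z ≠ 0 → ‖g z‖ₑ ≤ G |z|) :
    ‖tau κ x g y‖ₑ ≤ ENNReal.ofReal (8 * bk κ) * ∫⁻ u in Set.Ioo (-1 : ℝ) 1,
      G √(y ^ 2 + x ^ 2 - 2 * x * y * u) * ENNReal.ofReal ((1 - u ^ 2) ^ (κ - 1)) := by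
  have hb := bk_pos hκ
  rw [tau, enorm_mul, ← lintegral_const_mul' _ _ ENNReal.ofReal_ne_top]
  refine (mul_le_of_le_one_left zero_le ?_).trans
    ((enorm_integral_le_lintegral_enorm _).trans ?_)
  · rw [← ofReal_norm]
    norm_num
  refine setLIntegral_mono' measurableSet_Ioo fun u hu => ?_
  have hw := translation_weight_le (x := x) (y := y) hu
  obtain ⟨hu1, hu2⟩ := hu
  have hu3 : 0 < 1 - u ^ 2 := by nlinarith
  have hρ : 0 < √(y ^ 2 + x ^ 2 - 2 * x * y * u) := by
    refine sqrt_pos.2 ?_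
    have : 0 < x ^ 2 := by positivity
    nlinarith [sq_nonneg (y - x * u), mul_pos this hu3]
  set ρ := √(y ^ 2 + x ^ 2 - 2 * x * y * u)
  have h1 : ‖g ρ‖ₑ ≤ G ρ := by simpa [abs_of_pos hρ] using hg ρ hρ.ne'
  have h2 : ‖g (-ρ)‖ₑ ≤ G ρ := by simpa [abs_of_pos hρ] using hg (-ρ) (neg_ne_zero.2 hρ.ne')
  have e : ∀ a : ℝ, ‖(a : ℂ)‖ₑ = ENNReal.ofReal |a| := fun a => by
    rw [← ofReal_norm, Complex.norm_real, norm_eq_abs]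
  set w₁ := 1 + (y - x) / ρ
  set w₂ := 1 - (y - x) / ρ
  have hp : 0 < (1 - u ^ 2) ^ (κ - 1) := rpow_pos_of_pos hu3 _
  calc ‖(g ρ * (w₁ : ℂ) + g (-ρ) * (w₂ : ℂ)) * (Phi κ u : ℂ)‖ₑ
      ≤ (G ρ * ENNReal.ofReal |w₁| + G ρ * ENNReal.ofReal |w₂|) * ENNReal.ofReal |Phi κ u| := by
        rw [enorm_mul, e]
        gcongr
        refine (enorm_add_le _ _).trans ?_
        rw [enorm_mul, enorm_mul, e, e]
        gcongr
    _ = G ρ * ENNReal.ofReal ((|w₁| + |w₂|) * |Phi κ u|) := by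
        rw [ENNReal.ofReal_mul (by positivity), ENNReal.ofReal_add (abs_nonneg _) (abs_nonneg _)]
        ring
    _ ≤ G ρ * ENNReal.ofReal (8 * bk κ * (1 - u ^ 2) ^ (κ - 1)) := by
        refine mul_le_mul_right (ENNReal.ofReal_le_ofReal ?_) _
        have hu4 : 0 < 1 + u := by linarith
        have hPhi : |Phi κ u| = bk κ * (1 + u) * (1 - u ^ 2) ^ (κ - 1) := by
          rw [Phi]
          exact abs_of_nonneg (by positivity)
        rw [hPhi]
        calc _ = ((|w₁| + |w₂|) * (1 + u)) * (bk κ * (1 - u ^ 2) ^ (κ - 1)) := by ring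
          _ ≤ 8 * (bk κ * (1 - u ^ 2) ^ (κ - 1)) := by gcongr
          _ = _ := by ring
    _ = _ := by
        rw [ENNReal.ofReal_mul (by positivity)]
        ring

theorem enorm_dil_le {κ : ℝ} (hκ : 0 < κ) {φ : ℝ → ℂ} {ψ₀ : ℝ → ℝ}
    (hdiff : DifferentiableOn ℝ ψ₀ (Set.Ici 0)) (hlim : Tendsto ψ₀ atTop (𝓝 0))
    (hint : IntegrableOn (fun r => r ^ (2 * κ + 1) * |deriv ψ₀ r|) (Set.Ioi 0))
    (hdom : ∀ x : ℝ, ‖φ x‖ ≤ ψ₀ |x|) {ε : ℝ} (hε : 0 < ε) {z : ℝ} (hz : z ≠ 0) :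
    ‖dil κ φ ε z‖ₑ ≤ ENNReal.ofReal (ε ^ (-(2 * κ + 1))) *
      ∫⁻ R in Set.Ioi 0, (Set.Ioi (|z| / ε)).indicator (fun R => ‖deriv ψ₀ R‖ₑ) R := by
  rw [dil, enorm_mul]
  gcongr
  · rw [← ofReal_norm, Complex.norm_real, norm_eq_abs, abs_of_pos (by positivity)]
  · refine le_trans ?_ (ofReal_le_lintegral_enorm_deriv hκ hdiff hlim hint (by positivity))
    rw [← ofReal_norm]
    refine ENNReal.ofReal_le_ofReal ((hdom _).trans_eq ?_)
    rw [abs_div, abs_of_pos hε]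

/-- Integrating a superposition of translated balls against a measure whose averages over the
sets `||x| - |y|| ≤ r` are at most `l`. -/
theorem lintegral_layer_cake_le {κ : ℝ} (hκ : 0 < κ) {ν : Measure ℝ} [SFinite ν] {x ε : ℝ}
    (hε : 0 < ε) {h : ℝ → ℝ≥0∞} (hh : Measurable h) {l : ℝ≥0∞}
    (hν : ∀ r, 0 < r → ν {y | abs (|x| - |y|) ≤ r} ≤
      l * ENNReal.ofReal (2 * r * (|x| + r) ^ (2 * κ))) :
    ∫⁻ y, (∫⁻ u in Set.Ioo (-1 : ℝ) 1,
      (∫⁻ R in Set.Ioi 0, (Set.Ioi (√(y ^ 2 + x ^ 2 - 2 * x * y * u) / ε)).indicator h R) *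
        ENNReal.ofReal ((1 - u ^ 2) ^ (κ - 1))) ∂ν ≤
      l * ENNReal.ofReal (2 ^ (κ + 2) / κ * 9 ^ κ * ε ^ (2 * κ + 1)) *
        ∫⁻ R in Set.Ioi 0, ENNReal.ofReal (R ^ (2 * κ + 1)) * h R := by
  set w : ℝ → ℝ≥0∞ := fun u => ENNReal.ofReal ((1 - u ^ 2) ^ (κ - 1)) with hw
  have hwm : Measurable w := by fun_prop
  set K : ℝ := 2 ^ (κ + 1) / κ * 9 ^ κ with hK
  have hK0 : 0 < K := by positivity
  set C : ℝ → ℝ≥0∞ := fun R =>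
    ENNReal.ofReal (K * ((ε * R) ^ (2 * κ) / (|x| + ε * R) ^ (2 * κ))) with hC
  have hCm : Measurable C := by fun_prop
  have hinner : ∀ y, ∫⁻ u in Set.Ioo (-1 : ℝ) 1,
      (∫⁻ R in Set.Ioi 0, (Set.Ioi (√(y ^ 2 + x ^ 2 - 2 * x * y * u) / ε)).indicator h R) * w u ≤
      ∫⁻ R in Set.Ioi 0,
        {p : ℝ × ℝ | abs (|x| - |p.1|) ≤ ε * p.2}.indicator (fun p => C p.2 * h p.2) (y, R) := by
    intro y
    have hset : MeasurableSet
        {p : ℝ × ℝ | √(y ^ 2 + x ^ 2 - 2 * x * y * p.1) < ε * p.2} :=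
      measurableSet_lt (by fun_prop) (by fun_prop)
    calc _ = ∫⁻ u in Set.Ioo (-1 : ℝ) 1, ∫⁻ R in Set.Ioi 0,
          {p : ℝ × ℝ | √(y ^ 2 + x ^ 2 - 2 * x * y * p.1) < ε * p.2}.indicator
            (fun p => w p.1 * h p.2) (u, R) := by
          refine lintegral_congr fun u => ?_
          rw [mul_comm, ← lintegral_const_mul' _ _ ENNReal.ofReal_ne_top]
          refine lintegral_congr fun R => ?_
          simp only [Set.indicator_apply, Set.mem_Ioi, Set.mem_ofPred_eq, div_lt_iff₀' hε]
          split_ifs <;> simp [hw]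
      _ = ∫⁻ R in Set.Ioi 0, ∫⁻ u in Set.Ioo (-1 : ℝ) 1,
          {p : ℝ × ℝ | √(y ^ 2 + x ^ 2 - 2 * x * y * p.1) < ε * p.2}.indicator
            (fun p => w p.1 * h p.2) (u, R) := by
          refine lintegral_lintegral_swap (Measurable.aemeasurable ?_)
          exact Measurable.indicator (by fun_prop) hset
      _ ≤ _ := by
          refine setLIntegral_mono' measurableSet_Ioi fun R hR => ?_
          have hr : 0 < ε * R := mul_pos hε hR
          have key := lintegral_sqrt_lt_le hκ x y hr
          calc _ = ∫⁻ u in Set.Ioo (-1 : ℝ) 1,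
                {u : ℝ | √(y ^ 2 + x ^ 2 - 2 * x * y * u) < ε * R}.indicator w u * h R := by
                refine lintegral_congr fun u => ?_
                simp only [Set.indicator_apply, Set.mem_ofPred_eq]
                split_ifs <;> simp
            _ = (∫⁻ u in Set.Ioo (-1 : ℝ) 1,
                {u : ℝ | √(y ^ 2 + x ^ 2 - 2 * x * y * u) < ε * R}.indicator w u) * h R := by
                refine lintegral_mul_const _ (hwm.indicator ?_)
                exact measurableSet_lt (by fun_prop) (by fun_prop)
            _ ≤ _ := mul_le_mul_left key (h R)
            _ = _ := by
                simp only [Set.indicator_apply, Set.mem_ofPred_eq]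
                split_ifs <;> simp [hC, hK]
  have hset : MeasurableSet {p : ℝ × ℝ | abs (|x| - |p.1|) ≤ ε * p.2} :=
    measurableSet_le (by fun_prop) (by fun_prop)
  calc _ ≤ ∫⁻ y, (∫⁻ R in Set.Ioi 0, {p : ℝ × ℝ | abs (|x| - |p.1|) ≤ ε * p.2}.indicator
          (fun p => C p.2 * h p.2) (y, R)) ∂ν :=
        lintegral_mono hinner
    _ = ∫⁻ R in Set.Ioi 0, (∫⁻ y,
        {p : ℝ × ℝ | abs (|x| - |p.1|) ≤ ε * p.2}.indicator
          (fun p => C p.2 * h p.2) (y, R) ∂ν) := by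
        refine lintegral_lintegral_swap (Measurable.aemeasurable ?_)
        exact Measurable.indicator (by fun_prop) hset
    _ = ∫⁻ R in Set.Ioi 0, C R * h R * ν {y | abs (|x| - |y|) ≤ ε * R} := by
        refine lintegral_congr fun R => ?_
        rw [← lintegral_indicator_const (measurableSet_le (by fun_prop) (by fun_prop))]
        rfl
    _ ≤ ∫⁻ R in Set.Ioi 0, l * ENNReal.ofReal (2 * K * ε ^ (2 * κ + 1)) *
          (ENNReal.ofReal (R ^ (2 * κ + 1)) * h R) := by
        refine setLIntegral_mono' measurableSet_Ioi fun R hR => ?_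
        have hR0 : 0 < R := hR
        have hr : 0 < ε * R := mul_pos hε hR
        have hx0 := abs_nonneg x
        refine (mul_le_mul_right (hν _ hr) _).trans_eq ?_
        have : C R * ENNReal.ofReal (2 * (ε * R) * (|x| + ε * R) ^ (2 * κ)) =
            ENNReal.ofReal (2 * K * ε ^ (2 * κ + 1)) * ENNReal.ofReal (R ^ (2 * κ + 1)) := by
          rw [hC, ← ENNReal.ofReal_mul (by positivity), ← ENNReal.ofReal_mul (by positivity)]
          congr 1
          rw [mul_rpow hε.le hR0.le, rpow_add_one hε.ne', rpow_add_one hR0.ne']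
          field_simp
        calc _ = l * (C R * ENNReal.ofReal (2 * (ε * R) * (|x| + ε * R) ^ (2 * κ))) * h R := by
              ring
          _ = _ := by rw [this]; ring
    _ = _ := by
        rw [lintegral_const_mul _ (by fun_prop)]
        congr 4
        rw [hK, show κ + 2 = (κ + 1) + 1 by ring, rpow_add_one (by norm_num) (κ + 1)]
        ring

theorem measure_abs_sub_abs_le (ν : Measure ℝ) (x r : ℝ) :
    ν {y | abs (|x| - |y|) ≤ r} ≤
      (ν + ν.map (fun y => -y)) (Metric.closedBall x r) := by
  rw [Measure.add_apply, Measure.map_apply measurable_neg measurableSet_closedBall]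
  refine (measure_mono fun y hy => ?_).trans (measure_union_le _ _)
  simp only [Set.mem_ofPred_eq, Set.mem_union, Metric.mem_closedBall, Real.dist_eq,
    Set.mem_preimage] at hy ⊢
  rw [abs_le] at hy
  rw [abs_le, abs_le]
  rcases abs_cases x with h | h <;> rcases abs_cases y with h' | h'
  · left; constructor <;> linarith
  · right; constructor <;> linarith
  · right; constructor <;> linarith
  · left; constructor <;> linarith

instance (κ : ℝ) : SFinite (mu κ) := inferInstanceAs (SFinite (Measure.withDensity _ _))

theorem enorm_conv_dil_le {κ : ℝ} (hκ : 0 < κ) {φ : ℝ → ℂ} {ψ₀ : ℝ → ℝ}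
    (hdiff : DifferentiableOn ℝ ψ₀ (Set.Ici 0)) (hlim : Tendsto ψ₀ atTop (𝓝 0))
    (hint : IntegrableOn (fun r => r ^ (2 * κ + 1) * |deriv ψ₀ r|) (Set.Ioi 0))
    (hdom : ∀ x : ℝ, ‖φ x‖ ≤ ψ₀ |x|) {f : ℝ → ℂ} (hf : AEStronglyMeasurable f (mu κ))
    {ε : ℝ} (hε : 0 < ε) {x : ℝ} (hx : x ≠ 0) {l : ℝ≥0∞}
    (hν : ∀ r, 0 < r → (mu κ).withDensity (fun y => ‖f y‖ₑ) {y | abs (|x| - |y|) ≤ r} ≤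
      l * ENNReal.ofReal (2 * r * (|x| + r) ^ (2 * κ))) :
    ‖conv κ f (dil κ φ ε) x‖ₑ ≤
      l * ENNReal.ofReal (8 * bk κ * (2 ^ (κ + 2) / κ * 9 ^ κ) *
        ∫ R in Set.Ioi 0, R ^ (2 * κ + 1) * |deriv ψ₀ R|) := by
  have hb := bk_pos hκ
  set h : ℝ → ℝ≥0∞ := fun R => ‖deriv ψ₀ R‖ₑ with hh
  have hhm : Measurable h := (measurable_deriv ψ₀).enorm
  set c : ℝ≥0∞ := ENNReal.ofReal (ε ^ (-(2 * κ + 1))) with hc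
  set G : ℝ → ℝ≥0∞ := fun y => ∫⁻ u in Set.Ioo (-1 : ℝ) 1,
      (∫⁻ R in Set.Ioi 0, (Set.Ioi (√(y ^ 2 + x ^ 2 - 2 * x * y * u) / ε)).indicator h R) *
        ENNReal.ofReal ((1 - u ^ 2) ^ (κ - 1)) with hG
  have hGm : Measurable G := by
    refine Measurable.lintegral_prod_right (Measurable.mul (Measurable.lintegral_prod_right'
      (f := fun p : (ℝ × ℝ) × ℝ => (Set.Ioi (√(p.1.1 ^ 2 + x ^ 2 - 2 * x * p.1.1 * p.1.2) /
        ε)).indicator h p.2) ?_) (by fun_prop))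
    have hset : MeasurableSet
        {p : (ℝ × ℝ) × ℝ | √(p.1.1 ^ 2 + x ^ 2 - 2 * x * p.1.1 * p.1.2) / ε < p.2} :=
      measurableSet_lt (by fun_prop) (by fun_prop)
    exact Measurable.indicator (f := fun p : (ℝ × ℝ) × ℝ => h p.2) (by fun_prop) hset
  have htau : ∀ y, ‖tau κ x (fun z => dil κ φ ε (-z)) y‖ₑ ≤
      ENNReal.ofReal (8 * bk κ) * c * G y := by
    intro y
    refine (enorm_tau_le hκ hx y (G := fun r => c *
      ∫⁻ R in Set.Ioi 0, (Set.Ioi (r / ε)).indicator h R) fun z hz => ?_).trans_eq ?_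
    · have := enorm_dil_le hκ hdiff hlim hint hdom hε (neg_ne_zero.2 hz)
      rwa [abs_neg] at this
    · rw [mul_assoc _ c (G y), hG, ← lintegral_const_mul' c _ ENNReal.ofReal_ne_top]
      congr 1
      exact lintegral_congr fun u => mul_assoc _ _ _
  have hA : ∫⁻ R in Set.Ioi 0, ENNReal.ofReal (R ^ (2 * κ + 1)) * h R =
      ENNReal.ofReal (∫ R in Set.Ioi 0, R ^ (2 * κ + 1) * |deriv ψ₀ R|) := by
    rw [ofReal_integral_eq_lintegral_ofReal hint]
    · refine setLIntegral_congr_fun measurableSet_Ioi fun R hR => ?_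
      have hR0 : 0 < R := hR
      simp only [hh]
      rw [ENNReal.ofReal_mul (by positivity), ← ofReal_norm, norm_eq_abs]
    · filter_upwards [ae_restrict_mem measurableSet_Ioi] with R hR
      have hR0 : 0 < R := hR
      simp only [Pi.zero_apply]
      positivity
  calc ‖conv κ f (dil κ φ ε) x‖ₑ
      ≤ ∫⁻ y, ‖f y * tau κ x (fun z => dil κ φ ε (-z)) y‖ₑ ∂(mu κ) :=
        enorm_integral_le_lintegral_enorm _
    _ ≤ ∫⁻ y, ENNReal.ofReal (8 * bk κ) * c * (‖f y‖ₑ * G y) ∂(mu κ) := by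
        refine lintegral_mono fun y => ?_
        simp only
        rw [enorm_mul, mul_left_comm]
        gcongr
        exact htau y
    _ = ENNReal.ofReal (8 * bk κ) * c * ∫⁻ y, G y ∂(mu κ).withDensity (fun y => ‖f y‖ₑ) := by
        rw [lintegral_const_mul' _ _ (ENNReal.mul_ne_top ENNReal.ofReal_ne_top
          ENNReal.ofReal_ne_top),
          lintegral_withDensity_eq_lintegral_mul₀ hf.enorm hGm.aemeasurable]
        rfl
    _ ≤ ENNReal.ofReal (8 * bk κ) * c *
        (l * ENNReal.ofReal (2 ^ (κ + 2) / κ * 9 ^ κ * ε ^ (2 * κ + 1)) *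
        ENNReal.ofReal (∫ R in Set.Ioi 0, R ^ (2 * κ + 1) * |deriv ψ₀ R|)) := by
        gcongr
        rw [← hA]
        exact lintegral_layer_cake_le hκ hε hhm hν
    _ = _ := by
        rw [ENNReal.ofReal_mul (q := ∫ R in Set.Ioi 0, R ^ (2 * κ + 1) * |deriv ψ₀ R|)
          (by positivity), ENNReal.ofReal_mul (p := 8 * bk κ) (by positivity),
          ENNReal.ofReal_mul (q := ε ^ (2 * κ + 1)) (by positivity)]
        have : c * ENNReal.ofReal (ε ^ (2 * κ + 1)) = 1 := by
          rw [hc, ← ENNReal.ofReal_mul (by positivity), ← rpow_add hε]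
          simp
        calc _ = (c * ENNReal.ofReal (ε ^ (2 * κ + 1))) * (l * (ENNReal.ofReal (8 * bk κ) *
            ENNReal.ofReal (2 ^ (κ + 2) / κ * 9 ^ κ) *
            ENNReal.ofReal (∫ R in Set.Ioi 0, R ^ (2 * κ + 1) * |deriv ψ₀ R|))) := by ring
          _ = _ := by rw [this, one_mul]

/-- weak type `(1,1)` of `f ↦ sup_{ε>0} |f *_κ φ_ε|` for kernels dominated by
a nice radial kernel. -/
theorem weak_type_nonradial (κ : ℝ) (hκ : 0 < κ) (φ : ℝ → ℂ) (hφ : Integrable φ (mu κ))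
    (ψ₀ : ℝ → ℝ) (hψ₀nonneg : ∀ r, 0 ≤ r → 0 ≤ ψ₀ r)
    (hdiff : DifferentiableOn ℝ ψ₀ (Set.Ici 0))
    (hlim : Tendsto ψ₀ atTop (nhds 0))
    (hint : IntegrableOn (fun r => r ^ (2 * κ + 1) * |deriv ψ₀ r|) (Set.Ioi 0))
    (hψ1 : Integrable (fun x => (ψ₀ |x| : ℝ)) (mu κ))
    (hdom : ∀ x : ℝ, ‖φ x‖ ≤ ψ₀ |x|) :
    ∃ c : ℝ, ∀ f : ℝ → ℂ, Integrable f (mu κ) → ∀ a : ℝ, 0 < a →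
      mu κ {x | a < ⨆ ε : {ε : ℝ // 0 < ε}, ‖conv κ f (dil κ φ (ε : ℝ)) x‖} ≤
        ENNReal.ofReal (c / a) * eLpNorm f 1 (mu κ) := by
  obtain ⟨N, hN⟩ := exists_besicovitch_weak_type
  have hb := bk_pos hκ
  set B : ℝ := 8 * bk κ * (2 ^ (κ + 2) / κ * 9 ^ κ) *
    ∫ R in Set.Ioi 0, R ^ (2 * κ + 1) * |deriv ψ₀ R| with hB
  have hB0 : 0 ≤ B := by
    refine mul_nonneg (by positivity) (setIntegral_nonneg measurableSet_Ioi fun R hR => ?_)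
    have hR0 : 0 < R := hR
    positivity
  refine ⟨2 * N * (B + 1), fun f hf a ha => ?_⟩
  set l : ℝ≥0∞ := ENNReal.ofReal (a / (B + 1)) with hl
  have hl0 : l ≠ 0 := by
    rw [hl, ne_eq, ENNReal.ofReal_eq_zero, not_le]
    positivity
  set ν : Measure ℝ := (mu κ).withDensity (fun y => ‖f y‖ₑ) with hν
  set ν' : Measure ℝ := ν + ν.map (fun y => -y) with hν'
  set E : Set ℝ := {x | ∃ r : ℝ, 0 < r ∧
    l * mu κ (Metric.closedBall x r) < ν' (Metric.closedBall x r)} with hE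
  have hνuniv : ν' Set.univ = 2 * eLpNorm f 1 (mu κ) := by
    rw [hν', Measure.add_apply, Measure.map_apply measurable_neg MeasurableSet.univ,
      Set.preimage_univ, hν, withDensity_apply _ MeasurableSet.univ, Measure.restrict_univ,
      eLpNorm_one_eq_lintegral_enorm, two_mul]
  have hsub : {x | a < ⨆ ε : {ε : ℝ // 0 < ε}, ‖conv κ f (dil κ φ (ε : ℝ)) x‖} ⊆ E ∪ {0} := by
    rintro x (hx : a < _)
    by_contra hx'
    simp only [Set.mem_union, Set.mem_singleton_iff, not_or, hE, Set.mem_ofPred_eq, not_exists,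
      not_and, not_lt] at hx'
    obtain ⟨hxE, hx0⟩ := hx'
    refine absurd hx (not_lt.2 ?_)
    have : Nonempty {ε : ℝ // 0 < ε} := ⟨⟨1, one_pos⟩⟩
    refine ciSup_le fun ε => ?_
    have key := enorm_conv_dil_le hκ hdiff hlim hint hdom hf.1 ε.2 hx0 (l := l) fun r hr =>
      (measure_abs_sub_abs_le _ x r).trans ((hxE r hr).trans
        (mul_le_mul_right (mu_closedBall_le hκ x hr) _))
    rw [← hB, hl, ← ENNReal.ofReal_mul (by positivity), ← ofReal_norm,
      ENNReal.ofReal_le_ofReal_iff (by positivity)] at key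
    refine key.trans ?_
    rw [div_mul_eq_mul_div, div_le_iff₀ (by positivity)]
    nlinarith
  have hzero : mu κ {0} = 0 :=
    withDensity_absolutelyContinuous _ _ (by simp)
  calc _ ≤ mu κ E + mu κ {0} := (measure_mono hsub).trans (measure_union_le _ _)
    _ = mu κ E := by rw [hzero, add_zero]
    _ ≤ N * ν' Set.univ / l := by
        rw [ENNReal.le_div_iff_mul_le (Or.inl hl0) (Or.inl ENNReal.ofReal_ne_top), mul_comm]
        exact hN _ _ _
    _ = _ := by
        rw [hνuniv, div_eq_mul_inv, hl, ← ENNReal.ofReal_inv_of_pos (by positivity), inv_div,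
          mul_div_assoc, ENNReal.ofReal_mul (by positivity), ENNReal.ofReal_mul (by norm_num),
          ENNReal.ofReal_natCast, ENNReal.ofReal_ofNat]
        ring
end

section
/- Inversion formula for the Dunkl transform: for every κ > 0, if f ∈ L¹(μ_κ) is continuous and its Dunkl transform f̂ also belongs to L¹(μ_κ), then for every x ∈ ℝ, f(x) = c_κ ∫_ℝ f̂(y) E(x, iy) dμ_κ(y). -/
open MeasureTheory Real Filter Topology

/-- The one-dimensional Dunkl kernel `E(z,w)` for the reflection group `ℤ₂`. -/
noncomputable def Ek (κ : ℝ) (z w : ℂ) : ℂ :=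
  (bk κ : ℂ) * ∫ u in Set.Ioo (-1 : ℝ) 1,
    Complex.exp (z * w * (u : ℂ)) * (((1 + u) * (1 - u ^ 2) ^ (κ - 1) : ℝ) : ℂ)

/-- The constant `c_κ` with `c_κ⁻¹ = ∫ e^{-x²/2} dμ_κ(x)`. -/
noncomputable def ck (κ : ℝ) : ℝ := (∫ x, Real.exp (-x ^ 2 / 2) ∂(mu κ))⁻¹

/-- The Dunkl transform `f̂(y) = c_κ ∫ f(x) E(x,-iy) dμ_κ(x)`. -/
noncomputable def dunkl (κ : ℝ) (f : ℝ → ℂ) (y : ℝ) : ℂ :=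
  (ck κ : ℂ) * ∫ x, f x * Ek κ (x : ℂ) (-Complex.I * (y : ℂ)) ∂(mu κ)

open Set

section MuIntegrals

variable {E : Type*} [NormedAddCommGroup E] [NormedSpace ℝ E]

lemma integral_mu (κ : ℝ) (g : ℝ → E) :
    ∫ x, g x ∂(mu κ) = ∫ x, |x| ^ (2 * κ) • g x := by
  rw [mu, integral_withDensity_eq_integral_toReal_smul (by fun_prop) (by simp)]
  refine integral_congr_ae (Eventually.of_forall fun x => ?_)
  simp only [ENNReal.toReal_ofReal (Real.rpow_nonneg (abs_nonneg x) _)]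

lemma integrable_mu_iff (κ : ℝ) (g : ℝ → E) :
    Integrable g (mu κ) ↔ Integrable fun x => |x| ^ (2 * κ) • g x := by
  rw [mu, integrable_withDensity_iff_integrable_smul' (by fun_prop) (by simp)]
  refine integrable_congr (Eventually.of_forall fun x => ?_)
  simp only [ENNReal.toReal_ofReal (Real.rpow_nonneg (abs_nonneg x) _)]

lemma integral_eq_integral_Ioi_add_neg {g : ℝ → E} (hg : Integrable g) :
    ∫ x, g x = ∫ x in Ioi 0, (g x + g (-x)) := by
  rw [integral_add hg.integrableOn hg.comp_neg.integrableOn, integral_comp_neg_Ioi, neg_zero,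
    add_comm, intervalIntegral.integral_Iic_add_Ioi hg.integrableOn hg.integrableOn]

lemma integral_mu_eq_integral_Ioi (κ : ℝ) {g : ℝ → E} (hg : Integrable g (mu κ)) :
    ∫ x, g x ∂(mu κ) = ∫ x in Ioi 0, x ^ (2 * κ) • (g x + g (-x)) := by
  rw [integral_mu, integral_eq_integral_Ioi_add_neg ((integrable_mu_iff κ g).1 hg)]
  refine setIntegral_congr_fun measurableSet_Ioi fun x hx => ?_
  simp only [abs_neg, abs_of_pos (mem_Ioi.1 hx), smul_add]

lemma integrableOn_Ioi_of_integrable_mu (κ : ℝ) {g : ℝ → E} (hg : Integrable g (mu κ)) :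
    IntegrableOn (fun x => x ^ (2 * κ) • (g x + g (-x))) (Ioi 0) := by
  have h := (integrable_mu_iff κ g).1 hg
  refine (h.add h.comp_neg).integrableOn.congr_fun (fun x hx => ?_) measurableSet_Ioi
  simp only [Pi.add_apply, abs_neg, abs_of_pos (mem_Ioi.1 hx), smul_add]

end MuIntegrals

instance sFinite_mu (κ : ℝ) : SFinite (mu κ) := by unfold mu; infer_instance

lemma integrableOn_one_sub_sq_rpow {κ : ℝ} (hκ : 0 < κ) :
    IntegrableOn (fun u : ℝ => (1 - u ^ 2) ^ (κ - 1)) (Ioo (-1) 1) := by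
  have h0 : IntervalIntegrable (fun u : ℝ => (1 - u ^ 2) ^ (κ - 1)) volume 0 1 := by
    have h1 : IntervalIntegrable (fun u : ℝ => (1 - u) ^ (κ - 1)) volume 0 1 := by
      have := (intervalIntegral.intervalIntegrable_rpow' (a := 0) (b := 1)
        (r := κ - 1) (by linarith)).comp_sub_left 1
      simpa using this.symm
    have h2 : ContinuousOn (fun u : ℝ => (1 + u) ^ (κ - 1)) (uIcc 0 1) := by
      intro u hu
      rw [uIcc_of_le zero_le_one] at hu
      have hu' : 1 + u ≠ 0 := by linarith [hu.1]
      exact (ContinuousAt.rpow_const (f := fun u : ℝ => 1 + u) (by fun_prop)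
        (Or.inl hu')).continuousWithinAt
    refine (h1.mul_continuousOn h2).congr fun u hu => ?_
    rw [uIoc_of_le zero_le_one] at hu
    rw [← Real.mul_rpow (by linarith [hu.2]) (by linarith [hu.1])]
    ring_nf
  have h1 : IntervalIntegrable (fun u : ℝ => (1 - u ^ 2) ^ (κ - 1)) volume (-1) 0 := by
    rw [IntervalIntegrable.iff_comp_neg]
    simpa using h0.symm
  have := h1.trans h0
  rw [intervalIntegrable_iff_integrableOn_Ioo_of_le (by norm_num)] at this
  exact this

lemma integrableOn_dunklWeight {κ : ℝ} (hκ : 0 < κ) :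
    IntegrableOn (fun u : ℝ => (1 + u) * (1 - u ^ 2) ^ (κ - 1)) (Ioo (-1) 1) := by
  refine (integrableOn_one_sub_sq_rpow hκ).bdd_mul (c := 2) (by fun_prop) ?_
  refine (ae_restrict_iff' measurableSet_Ioo).2 (Eventually.of_forall fun u hu => ?_)
  rw [Real.norm_eq_abs, abs_le]
  constructor <;> linarith [hu.1, hu.2]

/-- The Dunkl kernel `E(x, iy)` as a function of the product `t = xy`. -/
noncomputable def dunklChar (κ t : ℝ) : ℂ :=
  (bk κ : ℂ) * ∫ u in Ioo (-1 : ℝ) 1,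
    Complex.exp (Complex.I * (t * u : ℝ)) * (((1 + u) * (1 - u ^ 2) ^ (κ - 1) : ℝ) : ℂ)

lemma Ek_I_mul (κ x y : ℝ) : Ek κ x (Complex.I * y) = dunklChar κ (x * y) := by
  rw [Ek, dunklChar]
  congr 2
  ext u
  congr 2
  push_cast
  ring

lemma Ek_neg_I_mul (κ x y : ℝ) : Ek κ x (-Complex.I * y) = dunklChar κ (-(x * y)) := by
  rw [Ek, dunklChar]
  congr 2
  ext u
  congr 2
  push_cast
  ring

lemma norm_exp_I_mul_ofReal_mul (t : ℝ) (z : ℂ) :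
    ‖Complex.exp (Complex.I * (t : ℝ)) * z‖ = ‖z‖ := by
  rw [norm_mul, mul_comm, mul_comm Complex.I, Complex.norm_exp_ofReal_mul_I, mul_one]

lemma integrableOn_exp_mul_dunklWeight {κ : ℝ} (hκ : 0 < κ) (t : ℝ) :
    IntegrableOn (fun u : ℝ => Complex.exp (Complex.I * (t * u : ℝ)) *
      (((1 + u) * (1 - u ^ 2) ^ (κ - 1) : ℝ) : ℂ)) (Ioo (-1) 1) := by
  refine (integrableOn_dunklWeight hκ).ofReal.bdd_mul (c := 1)
    (Continuous.aestronglyMeasurable (by fun_prop)) (Eventually.of_forall fun u => ?_)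
  simpa using (norm_exp_I_mul_ofReal_mul (t * u) 1).le

lemma exists_norm_dunklChar_le (κ : ℝ) : ∃ C, ∀ t, ‖dunklChar κ t‖ ≤ C := by
  refine ⟨‖(bk κ : ℂ)‖ * ∫ u in Ioo (-1 : ℝ) 1,
    ‖(((1 + u) * (1 - u ^ 2) ^ (κ - 1) : ℝ) : ℂ)‖, fun t => ?_⟩
  rw [dunklChar, norm_mul]
  gcongr
  refine (norm_integral_le_integral_norm _).trans_eq ?_
  simp_rw [norm_exp_I_mul_ofReal_mul]

lemma continuous_dunklChar {κ : ℝ} (hκ : 0 < κ) : Continuous (dunklChar κ) := by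
  refine continuous_const.mul (continuous_of_dominated (F := fun (t u : ℝ) =>
    Complex.exp (Complex.I * (t * u : ℝ)) * (((1 + u) * (1 - u ^ 2) ^ (κ - 1) : ℝ) : ℂ))
    (fun t => (integrableOn_exp_mul_dunklWeight hκ t).1)
    (fun t => Eventually.of_forall fun u => (norm_exp_I_mul_ofReal_mul _ _).le)
    (integrableOn_dunklWeight hκ).ofReal.norm
    (Eventually.of_forall fun u => by fun_prop))

lemma setIntegral_Ioo_comp_neg (g : ℝ → ℂ) :
    ∫ u in Ioo (-1 : ℝ) 1, g (-u) = ∫ u in Ioo (-1 : ℝ) 1, g u := by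
  simp_rw [← integral_Ioc_eq_integral_Ioo,
    ← intervalIntegral.integral_of_le (show (-1 : ℝ) ≤ 1 by norm_num)]
  simp

lemma dunklChar_neg (κ t : ℝ) : dunklChar κ (-t) = (bk κ : ℂ) * ∫ u in Ioo (-1 : ℝ) 1,
    Complex.exp (Complex.I * (t * u : ℝ)) * (((1 - u) * (1 - u ^ 2) ^ (κ - 1) : ℝ) : ℂ) := by
  rw [dunklChar, ← setIntegral_Ioo_comp_neg]
  simp [sub_eq_add_neg]

lemma integrableOn_exp_mul_dunklWeight_neg {κ : ℝ} (hκ : 0 < κ) (t : ℝ) :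
    IntegrableOn (fun u : ℝ => Complex.exp (Complex.I * (t * u : ℝ)) *
      (((1 - u) * (1 - u ^ 2) ^ (κ - 1) : ℝ) : ℂ)) (Ioo (-1) 1) := by
  have hw : IntegrableOn (fun u : ℝ => (((1 - u ^ 2) ^ (κ - 1) : ℝ) : ℂ)) (Ioo (-1) 1) :=
    (integrableOn_one_sub_sq_rpow hκ).ofReal
  refine ((hw.const_mul 2) |>.bdd_mul (c := 1)
    (f := fun u : ℝ => Complex.exp (Complex.I * (t * u : ℝ)))
    (Continuous.aestronglyMeasurable (by fun_prop)) (Eventually.of_forall fun u => ?_)).sub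
    (integrableOn_exp_mul_dunklWeight hκ t) |>.congr (Eventually.of_forall fun u => ?_)
  · simpa using (norm_exp_I_mul_ofReal_mul (t * u) 1).le
  · simp only [Pi.sub_apply]
    push_cast
    ring

lemma dunklChar_add_neg {κ : ℝ} (hκ : 0 < κ) (t : ℝ) :
    dunklChar κ t + dunklChar κ (-t) = 2 * (bk κ : ℂ) * ∫ u in Ioo (-1 : ℝ) 1,
      Complex.exp (Complex.I * (t * u : ℝ)) * (((1 - u ^ 2) ^ (κ - 1) : ℝ) : ℂ) := by
  rw [dunklChar_neg, dunklChar, ← mul_add, ← integral_add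
    (integrableOn_exp_mul_dunklWeight hκ t) (integrableOn_exp_mul_dunklWeight_neg hκ t),
    mul_comm 2, mul_assoc]
  congr 1
  rw [← integral_const_mul]
  congr 1
  ext u
  push_cast
  ring

lemma dunklChar_sub_neg {κ : ℝ} (hκ : 0 < κ) (t : ℝ) :
    dunklChar κ t - dunklChar κ (-t) = 2 * (bk κ : ℂ) * ∫ u in Ioo (-1 : ℝ) 1,
      u * Complex.exp (Complex.I * (t * u : ℝ)) * (((1 - u ^ 2) ^ (κ - 1) : ℝ) : ℂ) := by
  rw [dunklChar_neg, dunklChar, ← mul_sub, ← integral_sub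
    (integrableOn_exp_mul_dunklWeight hκ t) (integrableOn_exp_mul_dunklWeight_neg hκ t),
    mul_comm 2, mul_assoc]
  congr 1
  rw [← integral_const_mul]
  congr 1
  ext u
  push_cast
  ring

lemma image_cos_Ioo : Real.cos '' Ioo 0 π = Ioo (-1) 1 := by
  ext u
  constructor
  · rintro ⟨θ, hθ, rfl⟩
    have h := Real.strictAntiOn_cos
    constructor
    · rw [← Real.cos_pi]
      exact h ⟨hθ.1.le, hθ.2.le⟩ ⟨Real.pi_pos.le, le_rfl⟩ hθ.2
    · rw [← Real.cos_zero]
      exact h ⟨le_rfl, Real.pi_pos.le⟩ ⟨hθ.1.le, hθ.2.le⟩ hθ.1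
  · intro hu
    exact ⟨Real.arccos u, ⟨Real.arccos_pos.2 hu.2, Real.arccos_lt_pi.2 hu.1⟩,
      Real.cos_arccos hu.1.le hu.2.le⟩

lemma injOn_cos_Ioo : InjOn Real.cos (Ioo 0 π) :=
  Real.injOn_cos.mono Ioo_subset_Icc_self

lemma abs_neg_sin_mul_one_sub_cos_sq_rpow (κ : ℝ) {θ : ℝ} (hθ : θ ∈ Ioo 0 π) :
    |-Real.sin θ| * (1 - Real.cos θ ^ 2) ^ (κ - 1) = Real.sin θ ^ (2 * κ - 1) := by
  have hs : 0 < Real.sin θ := Real.sin_pos_of_mem_Ioo hθ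
  rw [abs_neg, abs_of_pos hs, ← Real.sin_sq, ← Real.rpow_natCast, ← Real.rpow_mul hs.le]
  nth_rewrite 1 [← Real.rpow_one (Real.sin θ)]
  rw [← Real.rpow_add hs]
  congr 1
  push_cast
  ring

lemma setIntegral_mul_one_sub_sq_rpow (κ : ℝ) (g : ℝ → ℂ) :
    ∫ u in Ioo (-1 : ℝ) 1, g u * (((1 - u ^ 2) ^ (κ - 1) : ℝ) : ℂ) =
      ∫ θ in Ioo 0 π, g (Real.cos θ) * ((Real.sin θ ^ (2 * κ - 1) : ℝ) : ℂ) := by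
  rw [← image_cos_Ioo, integral_image_eq_integral_abs_deriv_smul measurableSet_Ioo
    (fun θ _ => (Real.hasDerivAt_cos θ).hasDerivWithinAt) injOn_cos_Ioo]
  refine setIntegral_congr_fun measurableSet_Ioo fun θ hθ => ?_
  rw [← abs_neg_sin_mul_one_sub_cos_sq_rpow κ hθ, Complex.real_smul]
  push_cast
  ring

lemma integrableOn_sin_rpow {κ : ℝ} (hκ : 0 < κ) :
    IntegrableOn (fun θ => Real.sin θ ^ (2 * κ - 1)) (Ioo 0 π) := by
  have h := integrableOn_one_sub_sq_rpow hκ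
  rw [← image_cos_Ioo, integrableOn_image_iff_integrableOn_abs_deriv_smul measurableSet_Ioo
    (fun θ _ => (Real.hasDerivAt_cos θ).hasDerivWithinAt) injOn_cos_Ioo] at h
  exact h.congr_fun (fun θ hθ => abs_neg_sin_mul_one_sub_cos_sq_rpow κ hθ) measurableSet_Ioo

lemma integrableOn_one_add_mul_rpow_mul_exp {p b : ℝ} (hp : -1 < p) (hb : 0 < b) :
    IntegrableOn (fun y : ℝ => (1 + y) * (y ^ p * Real.exp (-b * y ^ 2))) (Ioi 0) := by
  refine ((integrable_rpow_mul_exp_neg_mul_sq hb hp).add (integrable_rpow_mul_exp_neg_mul_sq hb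
    (s := p + 1) (by linarith))).integrableOn.congr_fun (fun y hy => ?_) measurableSet_Ioi
  simp only [Pi.add_apply]
  rw [Real.rpow_add_one (mem_Ioi.1 hy).ne']
  ring

/-- A Gaussian integral over the upper half plane with weight `r ^ (2κ-1)`, in polar and in
Cartesian coordinates. -/
lemma integral_gaussian_polar {κ b : ℝ} (hκ : 0 < κ) (hb : 0 < b) {G : ℝ → ℂ}
    (hG : Continuous G) (hGb : ∀ a, ‖G a‖ ≤ 1 + |a|) :
    ∫ y in Ioi (0 : ℝ), ((y ^ (2 * κ) * Real.exp (-b * y ^ 2) : ℝ) : ℂ) *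
        ∫ u in Ioo (-1 : ℝ) 1, G (y * u) * (((1 - u ^ 2) ^ (κ - 1) : ℝ) : ℂ) =
      (∫ a : ℝ, G a * (Real.exp (-b * a ^ 2) : ℂ)) *
        ((∫ r in Ioi (0 : ℝ), r ^ (2 * κ - 1) * Real.exp (-b * r ^ 2) : ℝ) : ℂ) := by
  set K : ℝ × ℝ → ℂ := fun p => ((p.1 ^ (2 * κ) * Real.exp (-b * p.1 ^ 2) : ℝ) : ℂ) *
    (G (p.1 * Real.cos p.2) * ((Real.sin p.2 ^ (2 * κ - 1) : ℝ) : ℂ)) with hK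
  set F : ℝ × ℝ → ℂ := fun p => (G p.1 * (Real.exp (-b * p.1 ^ 2) : ℂ)) *
    ((p.2 ^ (2 * κ - 1) * Real.exp (-b * p.2 ^ 2) : ℝ) : ℂ) with hF
  have hKint : IntegrableOn K (Ioi 0 ×ˢ Ioo 0 π) (volume.prod volume) := by
    rw [IntegrableOn, ← Measure.prod_restrict]
    refine ((integrableOn_one_add_mul_rpow_mul_exp (p := 2 * κ) (by linarith) hb).mul_prod
      (integrableOn_sin_rpow hκ)).mono' ?_ ?_
    · exact Measurable.aestronglyMeasurable (by fun_prop)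
    · rw [Measure.prod_restrict]
      refine (ae_restrict_iff' (measurableSet_Ioi.prod measurableSet_Ioo)).2
        (Eventually.of_forall fun p hp => ?_)
      have hy : 0 < p.1 := hp.1
      have hs : 0 < Real.sin p.2 := Real.sin_pos_of_mem_Ioo hp.2
      have h1 : ‖G (p.1 * Real.cos p.2)‖ ≤ 1 + p.1 := by
        refine (hGb _).trans ?_
        rw [abs_mul, abs_of_pos hy]
        have := mul_le_mul_of_nonneg_left (Real.abs_cos_le_one p.2) hy.le
        linarith
      have h2 : 0 ≤ p.1 ^ (2 * κ) * Real.exp (-b * p.1 ^ 2) := by positivity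
      have h3 : 0 ≤ Real.sin p.2 ^ (2 * κ - 1) := by positivity
      rw [hK, norm_mul, norm_mul, Complex.norm_of_nonneg h2, Complex.norm_of_nonneg h3]
      calc _ ≤ p.1 ^ (2 * κ) * Real.exp (-b * p.1 ^ 2) *
            ((1 + p.1) * Real.sin p.2 ^ (2 * κ - 1)) := by gcongr
        _ = _ := by ring
  have hleft : ∫ y in Ioi (0 : ℝ), ((y ^ (2 * κ) * Real.exp (-b * y ^ 2) : ℝ) : ℂ) *
      ∫ u in Ioo (-1 : ℝ) 1, G (y * u) * (((1 - u ^ 2) ^ (κ - 1) : ℝ) : ℂ) =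
      ∫ p in Ioi 0 ×ˢ Ioo 0 π, K p ∂(volume.prod volume) := by
    rw [setIntegral_prod _ hKint]
    refine setIntegral_congr_fun measurableSet_Ioi fun y _ => ?_
    simp only [hK]
    rw [integral_const_mul, setIntegral_mul_one_sub_sq_rpow κ fun u => G (y * u)]
  have hright : ∫ p in univ ×ˢ Ioi (0 : ℝ), F p ∂(volume.prod volume) =
      (∫ a : ℝ, G a * (Real.exp (-b * a ^ 2) : ℂ)) *
        ((∫ r in Ioi (0 : ℝ), r ^ (2 * κ - 1) * Real.exp (-b * r ^ 2) : ℝ) : ℂ) := by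
    rw [setIntegral_prod_mul (fun a : ℝ => G a * (Real.exp (-b * a ^ 2) : ℂ))
      (fun r : ℝ => ((r ^ (2 * κ - 1) * Real.exp (-b * r ^ 2) : ℝ) : ℂ)), setIntegral_univ,
      integral_complex_ofReal]
  have hms : MeasurableSet ((univ : Set ℝ) ×ˢ Ioi (0 : ℝ)) :=
    MeasurableSet.univ.prod measurableSet_Ioi
  rw [hleft, ← hright, ← integral_indicator hms, ← Measure.volume_eq_prod,
    ← integral_comp_polarCoord_symm]
  have hset : Ioi (0 : ℝ) ×ˢ Ioo 0 π =
      polarCoord.target ∩ {p : ℝ × ℝ | 0 < p.1 * Real.sin p.2} := by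
    ext p
    simp only [polarCoord_target, mem_prod, mem_Ioi, mem_Ioo, mem_inter_iff, mem_ofPred_eq]
    constructor
    · rintro ⟨h1, h2, h3⟩
      exact ⟨⟨h1, by linarith, h3⟩, mul_pos h1 (Real.sin_pos_of_mem_Ioo ⟨h2, h3⟩)⟩
    · rintro ⟨⟨h1, h2, h3⟩, h4⟩
      refine ⟨h1, ?_, h3⟩
      by_contra! h5
      have := Real.sin_nonpos_of_nonpos_of_neg_pi_le h5 h2.le
      nlinarith
  rw [hset, ← setIntegral_indicator (measurableSet_lt (by fun_prop) (by fun_prop))]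
  refine setIntegral_congr_fun polarCoord.open_target.measurableSet fun p hp => ?_
  have hy : 0 < p.1 := hp.1
  rw [polarCoord_symm_apply]
  by_cases h : 0 < p.1 * Real.sin p.2
  · have hs : 0 < Real.sin p.2 := by
      by_contra! h'
      nlinarith
    rw [indicator_of_mem (by exact h), indicator_of_mem (by exact ⟨mem_univ _, h⟩)]
    simp only [hK, hF]
    rw [Real.mul_rpow hy.le hs.le, Complex.real_smul]
    have e1 : p.1 ^ (2 * κ) = p.1 * p.1 ^ (2 * κ - 1) := by
      nth_rewrite 2 [← Real.rpow_one p.1]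
      rw [← Real.rpow_add hy]
      congr 1
      ring
    have e2 : Real.exp (-b * p.1 ^ 2) = Real.exp (-b * (p.1 * Real.cos p.2) ^ 2) *
        Real.exp (-b * (p.1 * Real.sin p.2) ^ 2) := by
      rw [← Real.exp_add]
      congr 1
      linear_combination b * p.1 ^ 2 * Real.sin_sq_add_cos_sq p.2
    rw [e1, e2]
    push_cast
    ring
  · rw [indicator_of_notMem (by exact h), indicator_of_notMem (fun h' => h h'.2), smul_zero]

lemma integrable_comp_abs_of_integrableOn_Ioi {f : ℝ → ℝ} (hf : IntegrableOn f (Ioi 0)) :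
    Integrable fun x => f |x| := by
  have h1 : IntegrableOn (fun x => f |x|) (Ioi 0) :=
    hf.congr_fun (fun x hx => by rw [abs_of_pos (mem_Ioi.1 hx)]) measurableSet_Ioi
  have h2 : IntegrableOn (fun x => f |x|) (Iio 0) := by
    have := (integrable_indicator_iff measurableSet_Ioi).2 h1 |>.comp_neg
    refine ((integrable_indicator_iff measurableSet_Iio).1 (this.congr
      (Eventually.of_forall fun x => ?_)))
    simp [indicator, abs_neg]
  rw [← integrableOn_univ, ← Iio_union_Ici (a := (0 : ℝ)), integrableOn_union,
    integrableOn_Ici_iff_integrableOn_Ioi]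
  exact ⟨h2, h1⟩

lemma integrable_mul_exp_mu {κ b : ℝ} (hκ : 0 < κ) (hb : 0 < b) {q : ℝ → ℂ}
    (hq : Continuous q) (hqb : ∀ x, ‖q x‖ ≤ 1 + |x|) :
    Integrable (fun x => q x * (Real.exp (-b * x ^ 2) : ℂ)) (mu κ) := by
  rw [integrable_mu_iff]
  have h := integrable_comp_abs_of_integrableOn_Ioi
    (integrableOn_one_add_mul_rpow_mul_exp (p := 2 * κ) (by linarith) hb)
  refine h.mono' (Measurable.aestronglyMeasurable (by fun_prop)) (Eventually.of_forall fun x => ?_)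
  rw [norm_smul, norm_mul, Complex.norm_real, Real.norm_of_nonneg (by positivity),
    Real.norm_of_nonneg (by positivity), sq_abs]
  calc _ ≤ |x| ^ (2 * κ) * ((1 + |x|) * Real.exp (-b * x ^ 2)) := by
        gcongr
        exact hqb x
    _ = _ := by ring

lemma integrable_mul_dunklChar {κ : ℝ} (hκ : 0 < κ) {φ : ℝ → ℂ} (hφ : Integrable φ (mu κ))
    (t : ℝ) : Integrable (fun y => φ y * dunklChar κ (t * y)) (mu κ) := by
  obtain ⟨C, hC⟩ := exists_norm_dunklChar_le κ
  have hc := continuous_dunklChar hκ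
  exact hφ.mul_bdd (c := C) (Continuous.aestronglyMeasurable (by fun_prop))
    (Eventually.of_forall fun y => hC _)

lemma inv_ck_eq {κ : ℝ} (hκ : 0 < κ) :
    (ck κ)⁻¹ = 2 ^ (κ + 1 / 2) * Real.Gamma (κ + 1 / 2) := by
  have h1 := integral_rpow_mul_exp_neg_mul_rpow (p := 2) (q := 2 * κ) (b := 1 / 2)
    (by norm_num) (by linarith) (by norm_num)
  rw [ck, inv_inv, integral_mu]
  have h2 := integral_comp_abs (f := fun x : ℝ => x ^ (2 * κ) * Real.exp (-(1 / 2) * x ^ (2 : ℝ)))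
  rw [h1] at h2
  have h3 : ∀ x : ℝ, |x| ^ (2 * κ) • Real.exp (-x ^ 2 / 2) =
      |x| ^ (2 * κ) * Real.exp (-(1 / 2) * |x| ^ (2 : ℝ)) := fun x => by
    rw [smul_eq_mul, Real.rpow_two, sq_abs]
    ring_nf
  simp_rw [h3]
  rw [h2, show -(2 * κ + 1) / 2 = -(κ + 1 / 2) by ring, show (2 * κ + 1) / 2 = κ + 1 / 2 by ring,
    one_div (2 : ℝ), Real.inv_rpow (by norm_num), Real.rpow_neg (by norm_num), inv_inv]
  ring

lemma ck_mul_bk_mul_gaussian {κ b : ℝ} (hκ : 0 < κ) (hb : 0 < b) :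
    ck κ * (2 * bk κ * ((π / b) ^ (1 / 2 : ℝ) *
      ∫ r in Ioi (0 : ℝ), r ^ (2 * κ - 1) * Real.exp (-b * r ^ 2))) =
      (2 * b) ^ (-(κ + 1 / 2)) := by
  have h1 := integral_rpow_mul_exp_neg_mul_rpow (p := 2) (q := 2 * κ - 1) (b := b)
    (by norm_num) (by linarith) hb
  simp_rw [Real.rpow_two] at h1
  rw [h1, ← inv_inv (ck κ), inv_ck_eq hκ, bk, show -(2 * κ - 1 + 1) / 2 = -κ by ring,
    show (2 * κ - 1 + 1) / 2 = κ by ring, Real.div_rpow Real.pi_pos.le hb.le,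
    ← Real.sqrt_eq_rpow π, Real.mul_rpow (by norm_num) hb.le,
    Real.rpow_neg (by norm_num : (0 : ℝ) ≤ 2),
    Real.rpow_neg hb.le, Real.rpow_neg hb.le, Real.rpow_add hb]
  have := Real.Gamma_pos_of_pos hκ
  have := Real.Gamma_pos_of_pos (show 0 < κ + 1 / 2 by linarith)
  have := Real.sqrt_pos.2 Real.pi_pos
  have : 0 < b ^ κ := by positivity
  have : 0 < b ^ (1 / 2 : ℝ) := by positivity
  have : (0 : ℝ) < 2 ^ (κ + 1 / 2) := by positivity
  field_simp

lemma integral_exp_mul_gaussian {b : ℝ} (hb : 0 < b) (t : ℝ) :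
    ∫ a : ℝ, Complex.exp (Complex.I * (t * a : ℝ)) * (Real.exp (-b * a ^ 2) : ℂ) =
      ((π / b) ^ (1 / 2 : ℝ) : ℝ) * (Real.exp (-t ^ 2 / (4 * b)) : ℂ) := by
  have h := fourierIntegral_gaussian (b := (b : ℂ)) (by simpa using hb) t
  rw [Complex.ofReal_cpow (by positivity)]
  push_cast
  simp_rw [← mul_assoc]
  exact h

lemma integrable_exp_mul_gaussian {b : ℝ} (hb : 0 < b) (t : ℝ) :
    Integrable fun a : ℝ =>
      Complex.exp (Complex.I * (t * a : ℝ)) * (Real.exp (-b * a ^ 2) : ℂ) := by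
  refine (integrable_exp_neg_mul_sq hb).ofReal.bdd_mul (c := 1)
    (Continuous.aestronglyMeasurable (by fun_prop)) (Eventually.of_forall fun a => ?_)
  simpa using (norm_exp_I_mul_ofReal_mul (t * a) 1).le

lemma integrable_mul_exp_mul_gaussian {b : ℝ} (hb : 0 < b) (t : ℝ) :
    Integrable fun a : ℝ =>
      a * Complex.exp (Complex.I * (t * a : ℝ)) * (Real.exp (-b * a ^ 2) : ℂ) := by
  refine ((integrable_mul_exp_neg_mul_sq hb).ofReal (𝕜 := ℂ) |>.bdd_mul (c := 1)
    (f := fun a : ℝ => Complex.exp (Complex.I * (t * a : ℝ)))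
    (Continuous.aestronglyMeasurable (by fun_prop)) (Eventually.of_forall fun a => ?_)).congr
    (Eventually.of_forall fun a => ?_)
  · simpa using (norm_exp_I_mul_ofReal_mul (t * a) 1).le
  · simp
    ring

lemma integral_mul_exp_mul_gaussian {b : ℝ} (hb : 0 < b) (t : ℝ) :
    ∫ a : ℝ, a * Complex.exp (Complex.I * (t * a : ℝ)) * (Real.exp (-b * a ^ 2) : ℂ) =
      Complex.I * t / (2 * b) *
        (((π / b) ^ (1 / 2 : ℝ) : ℝ) * (Real.exp (-t ^ 2 / (4 * b)) : ℂ)) := by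
  have hd : ∀ a : ℝ, HasDerivAt
      (fun a : ℝ => Complex.exp (Complex.I * (t * a : ℝ)) * (Real.exp (-b * a ^ 2) : ℂ))
      (Complex.I * t * (Complex.exp (Complex.I * (t * a : ℝ)) * (Real.exp (-b * a ^ 2) : ℂ)) -
        2 * b * (a * Complex.exp (Complex.I * (t * a : ℝ)) * (Real.exp (-b * a ^ 2) : ℂ))) a := by
    intro a
    have h1 : HasDerivAt (fun a : ℝ => Complex.exp (Complex.I * (t * a : ℝ)))
        (Complex.exp (Complex.I * (t * a : ℝ)) * (Complex.I * (t * 1 : ℝ))) a :=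
      (((hasDerivAt_id a).const_mul t).ofReal_comp.const_mul Complex.I).cexp
    have h2 : HasDerivAt (fun a : ℝ => (Real.exp (-b * a ^ 2) : ℂ))
        (Real.exp (-b * a ^ 2) * (-b * (2 * a)) : ℝ) a := by
      have := (((hasDerivAt_pow 2 a).const_mul (-b)).exp).ofReal_comp
      simpa using this
    refine (h1.mul h2).congr_deriv ?_
    push_cast
    ring
  have i1 := (integrable_exp_mul_gaussian hb t).const_mul (Complex.I * t)
  have i2 := (integrable_mul_exp_mul_gaussian hb t).const_mul (2 * b : ℂ)
  have h := integral_eq_zero_of_hasDerivAt_of_integrable hd (i1.sub i2)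
    (integrable_exp_mul_gaussian hb t)
  rw [integral_sub i1 i2, integral_const_mul, integral_const_mul, integral_exp_mul_gaussian hb,
    sub_eq_zero] at h
  have hb' : (b : ℂ) ≠ 0 := by exact_mod_cast hb.ne'
  rw [div_mul_eq_mul_div, h, mul_div_cancel_left₀ _ (mul_ne_zero two_ne_zero hb')]

lemma dunkl_gaussian {κ b : ℝ} (hκ : 0 < κ) (hb : 0 < b) (t : ℝ) :
    (ck κ : ℂ) * ∫ y, (Real.exp (-b * y ^ 2) : ℂ) * dunklChar κ (t * y) ∂(mu κ) =
      ((2 * b) ^ (-(κ + 1 / 2)) : ℝ) * (Real.exp (-t ^ 2 / (4 * b)) : ℂ) := by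
  have hi : Integrable (fun y : ℝ => (Real.exp (-b * y ^ 2) : ℂ)) (mu κ) := by
    simpa using integrable_mul_exp_mu hκ hb (q := fun _ => 1) continuous_const (by simp)
  have hp := integral_gaussian_polar hκ hb (G := fun a => Complex.exp (Complex.I * (t * a : ℝ)))
    (by fun_prop) fun a => by
      have := norm_exp_I_mul_ofReal_mul (t * a) 1
      rw [mul_one, norm_one] at this
      rw [this]
      linarith [abs_nonneg a]
  rw [integral_exp_mul_gaussian hb] at hp
  have hmu : ∫ y, (Real.exp (-b * y ^ 2) : ℂ) * dunklChar κ (t * y) ∂(mu κ) =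
      2 * (bk κ : ℂ) * ∫ y in Ioi (0 : ℝ), ((y ^ (2 * κ) * Real.exp (-b * y ^ 2) : ℝ) : ℂ) *
        ∫ u in Ioo (-1 : ℝ) 1, Complex.exp (Complex.I * (t * (y * u) : ℝ)) *
          (((1 - u ^ 2) ^ (κ - 1) : ℝ) : ℂ) := by
    rw [integral_mu_eq_integral_Ioi κ (integrable_mul_dunklChar hκ hi t), ← integral_const_mul]
    refine setIntegral_congr_fun measurableSet_Ioi fun y _ => ?_
    have h := dunklChar_add_neg hκ (t * y)
    simp only [neg_sq, mul_neg, Complex.real_smul, ← mul_add, h, mul_assoc t y]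
    push_cast
    ring
  rw [hmu, hp, ← ck_mul_bk_mul_gaussian hκ hb]
  push_cast
  ring

lemma dunkl_mul_gaussian {κ b : ℝ} (hκ : 0 < κ) (hb : 0 < b) (t : ℝ) :
    (ck κ : ℂ) * ∫ y, (y * (Real.exp (-b * y ^ 2) : ℂ)) * dunklChar κ (t * y) ∂(mu κ) =
      Complex.I / (2 * b) * ((2 * b) ^ (-(κ + 1 / 2)) : ℝ) *
        (t * (Real.exp (-t ^ 2 / (4 * b)) : ℂ)) := by
  have hi := integrable_mul_exp_mu hκ hb (q := fun y => (y : ℂ)) (by fun_prop) (by simp)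
  have hp := integral_gaussian_polar hκ hb
    (G := fun a => a * Complex.exp (Complex.I * (t * a : ℝ)))
    (by fun_prop) fun a => by
      rw [mul_comm, norm_exp_I_mul_ofReal_mul (t * a)]
      simp
  rw [integral_mul_exp_mul_gaussian hb] at hp
  have hmu : ∫ y, (y * (Real.exp (-b * y ^ 2) : ℂ)) * dunklChar κ (t * y) ∂(mu κ) =
      2 * (bk κ : ℂ) * ∫ y in Ioi (0 : ℝ), ((y ^ (2 * κ) * Real.exp (-b * y ^ 2) : ℝ) : ℂ) *
        ∫ u in Ioo (-1 : ℝ) 1, (y * u : ℝ) * Complex.exp (Complex.I * (t * (y * u) : ℝ)) *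
          (((1 - u ^ 2) ^ (κ - 1) : ℝ) : ℂ) := by
    rw [integral_mu_eq_integral_Ioi κ (integrable_mul_dunklChar hκ hi t), ← integral_const_mul]
    refine setIntegral_congr_fun measurableSet_Ioi fun y _ => ?_
    have h := dunklChar_sub_neg hκ (t * y)
    have h' : ∫ u in Ioo (-1 : ℝ) 1, (y * u : ℝ) * Complex.exp (Complex.I * (t * (y * u) : ℝ)) *
          (((1 - u ^ 2) ^ (κ - 1) : ℝ) : ℂ) = y * ∫ u in Ioo (-1 : ℝ) 1,
        u * Complex.exp (Complex.I * (t * y * u : ℝ)) * (((1 - u ^ 2) ^ (κ - 1) : ℝ) : ℂ) := by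
      rw [← integral_const_mul]
      refine integral_congr_ae (Eventually.of_forall fun u => ?_)
      simp only [← mul_assoc, Complex.ofReal_mul y]
    simp only [neg_sq, mul_neg, Complex.real_smul, Complex.ofReal_neg, h']
    push_cast at h ⊢
    linear_combination (y ^ (2 * κ) : ℝ) * y * Complex.exp (-b * y ^ 2) * h
  rw [hmu, hp, ← ck_mul_bk_mul_gaussian hκ hb]
  push_cast
  ring

open Polynomial in
lemma integral_mul_eval_exp_eq_zero {P : ℝ → ℂ}
    (hi : ∀ s > 0, IntegrableOn (fun x => P x * (Real.exp (-s * x ^ 2) : ℂ)) (Ioi 0))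
    (h0 : ∀ s > 0, ∫ x in Ioi 0, P x * (Real.exp (-s * x ^ 2) : ℂ) = 0) (p : ℝ[X]) :
    IntegrableOn (fun x => P x * (Real.exp (-1 * x ^ 2) : ℂ) *
        (p.eval (Real.exp (-1 * x ^ 2)) : ℝ)) (Ioi 0) ∧
      ∫ x in Ioi 0, P x * (Real.exp (-1 * x ^ 2) : ℂ) *
        (p.eval (Real.exp (-1 * x ^ 2)) : ℝ) = 0 := by
  induction p using Polynomial.induction_on' with
  | add p q hp hq =>
    simp only [eval_add, Complex.ofReal_add, mul_add]
    exact ⟨hp.1.add hq.1, by rw [integral_add hp.1 hq.1, hp.2, hq.2, add_zero]⟩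
  | monomial n a =>
    have hn : (0 : ℝ) < n + 1 := by positivity
    have h : ∀ x : ℝ, P x * (Real.exp (-1 * x ^ 2) : ℂ) *
        ((monomial n a).eval (Real.exp (-1 * x ^ 2)) : ℝ) =
        a * (P x * (Real.exp (-(n + 1) * x ^ 2) : ℂ)) := fun x => by
      rw [eval_monomial, ← Real.exp_nat_mul, show -((n : ℝ) + 1) * x ^ 2 =
        -1 * x ^ 2 + n * (-1 * x ^ 2) by ring, Real.exp_add]
      push_cast
      ring
    simp only [h]
    exact ⟨(hi _ hn).const_mul _, by rw [integral_const_mul, h0 _ hn, mul_zero]⟩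

lemma integral_mul_comp_exp_eq_zero {P : ℝ → ℂ}
    (hi : ∀ s > 0, IntegrableOn (fun x => P x * (Real.exp (-s * x ^ 2) : ℂ)) (Ioi 0))
    (h0 : ∀ s > 0, ∫ x in Ioi 0, P x * (Real.exp (-s * x ^ 2) : ℂ) = 0)
    {φ : ℝ → ℝ} (hφ : Continuous φ) :
    ∫ x in Ioi 0, P x * (Real.exp (-1 * x ^ 2) : ℂ) * (φ (Real.exp (-1 * x ^ 2)) : ℂ) = 0 := by
  have hmem : ∀ x : ℝ, Real.exp (-1 * x ^ 2) ∈ Icc (0 : ℝ) 1 := fun x =>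
    ⟨(Real.exp_pos _).le, Real.exp_le_one_iff.2 (by nlinarith [sq_nonneg x])⟩
  have hQ := hi 1 one_pos
  obtain ⟨C, hC⟩ := isCompact_Icc.exists_bound_of_continuousOn (hφ.continuousOn (s := Icc 0 1))
  have hQφ : IntegrableOn (fun x => P x * (Real.exp (-1 * x ^ 2) : ℂ) *
      (φ (Real.exp (-1 * x ^ 2)) : ℂ)) (Ioi 0) := by
    refine hQ.mul_bdd (c := C) (Continuous.aestronglyMeasurable (by fun_prop))
      (Eventually.of_forall fun x => ?_)
    rw [Complex.norm_real]
    exact hC _ (hmem x)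
  rw [← norm_le_zero_iff]
  set M := ∫ x in Ioi 0, ‖P x * (Real.exp (-1 * x ^ 2) : ℂ)‖ with hM
  have hM0 : 0 ≤ M := integral_nonneg fun x => norm_nonneg _
  refine le_of_forall_pos_le_add fun ε hε => ?_
  obtain ⟨p, hp⟩ := exists_polynomial_near_of_continuousOn 0 1 φ hφ.continuousOn (ε / (M + 1))
    (by positivity)
  obtain ⟨hpi, hp0⟩ := integral_mul_eval_exp_eq_zero hi h0 p
  rw [← norm_neg, ← zero_sub, ← hp0, ← integral_sub hpi hQφ, zero_add]
  calc _ ≤ ∫ x in Ioi 0, ‖P x * (Real.exp (-1 * x ^ 2) : ℂ)‖ * (ε / (M + 1)) := by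
        refine norm_integral_le_of_norm_le (hQ.norm.mul_const _) (Eventually.of_forall fun x => ?_)
        rw [← mul_sub, norm_mul, ← Complex.ofReal_sub, Complex.norm_real]
        gcongr
        exact (hp _ (hmem x)).le
    _ = M * (ε / (M + 1)) := by rw [integral_mul_const]
    _ ≤ ε := by
        rw [mul_div_assoc', div_le_iff₀ (by positivity)]
        nlinarith

/-- A continuous function on the half line that is orthogonal to all Gaussians vanishes. -/
lemma eq_zero_of_forall_integral_mul_exp_eq_zero {P : ℝ → ℂ} (hP : ContinuousOn P (Ioi 0))
    (hi : ∀ s > 0, IntegrableOn (fun x => P x * (Real.exp (-s * x ^ 2) : ℂ)) (Ioi 0))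
    (h0 : ∀ s > 0, ∫ x in Ioi 0, P x * (Real.exp (-s * x ^ 2) : ℂ) = 0) {x : ℝ} (hx : 0 < x) :
    P x = 0 := by
  have hQc : ContinuousOn (fun x => P x * (Real.exp (-1 * x ^ 2) : ℂ)) (Ioi 0) :=
    hP.mul (Continuous.continuousOn (by fun_prop))
  have hae := isOpen_Ioi.ae_eq_zero_of_integral_contDiff_smul_eq_zero (μ := volume)
    (hQc.locallyIntegrableOn measurableSet_Ioi) fun g hg hgc hgs => by
      obtain ⟨B, hB, hgB⟩ := hgc.exists_pos_le_norm
      have hmax : ∀ u : ℝ, max u (Real.exp (-1 * B ^ 2)) ≠ 0 := fun u =>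
        (lt_max_of_lt_right (Real.exp_pos _)).ne'
      have hφ : Continuous fun u : ℝ => g (√(-Real.log (max u (Real.exp (-1 * B ^ 2))))) :=
        hg.continuous.comp (((Continuous.log (by fun_prop) hmax).neg).sqrt)
      rw [← integral_mul_comp_exp_eq_zero hi h0 hφ]
      rw [← setIntegral_eq_integral_of_forall_compl_eq_zero (s := Ioi 0) fun y hy => by
        rw [image_eq_zero_of_notMem_tsupport fun h => hy (hgs h), zero_smul]]
      refine setIntegral_congr_fun measurableSet_Ioi fun y hy => ?_
      have hy0 : 0 < y := hy
      suffices g y = g (√(-Real.log (max (Real.exp (-1 * y ^ 2)) (Real.exp (-1 * B ^ 2))))) by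
        simp only [this, Complex.real_smul]
        ring
      rcases le_total y B with h | h
      · rw [max_eq_left (Real.exp_le_exp.2 (by nlinarith)), Real.log_exp,
          show -(-1 * y ^ 2) = y ^ 2 by ring, Real.sqrt_sq hy0.le]
      · rw [max_eq_right (Real.exp_le_exp.2 (by nlinarith)), Real.log_exp,
          show -(-1 * B ^ 2) = B ^ 2 by ring, Real.sqrt_sq hB.le,
          hgB y (h.trans (le_abs_self y)), hgB B (le_abs_self B)]
  have := Measure.eqOn_open_of_ae_eq (g := 0) ((ae_restrict_iff' measurableSet_Ioi).2 hae)
    isOpen_Ioi hQc continuousOn_const hx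
  simpa [Complex.exp_ne_zero] using this

/-- A continuous function on the line that is orthogonal to all Gaussians and to all first
Hermite functions vanishes. -/
lemma eq_zero_of_forall_integral_mu_eq_zero (κ : ℝ) {h : ℝ → ℂ} (hc : Continuous h)
    (hi : ∀ b > 0, Integrable (fun x => h x * (Real.exp (-b * x ^ 2) : ℂ)) (mu κ))
    (hi' : ∀ b > 0, Integrable (fun x => h x * (x * (Real.exp (-b * x ^ 2) : ℂ))) (mu κ))
    (h0 : ∀ b > 0, ∫ x, h x * (Real.exp (-b * x ^ 2) : ℂ) ∂(mu κ) = 0)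
    (h0' : ∀ b > 0, ∫ x, h x * (x * (Real.exp (-b * x ^ 2) : ℂ)) ∂(mu κ) = 0) : h = 0 := by
  have hpow : ContinuousOn (fun x : ℝ => ((x ^ (2 * κ) : ℝ) : ℂ)) (Ioi 0) :=
    Complex.continuous_ofReal.comp_continuousOn
      (continuousOn_id.rpow_const fun x hx => Or.inl (ne_of_gt hx))
  have e : ∀ b x : ℝ, ((x ^ (2 * κ) : ℝ) : ℂ) * (h x + h (-x)) * (Real.exp (-b * x ^ 2) : ℂ) =
      x ^ (2 * κ) • (h x * (Real.exp (-b * x ^ 2) : ℂ) +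
        h (-x) * (Real.exp (-b * (-x) ^ 2) : ℂ)) := fun b x => by
    rw [Complex.real_smul, neg_sq]
    ring
  have e' : ∀ b x : ℝ,
      ((x ^ (2 * κ) : ℝ) : ℂ) * (x * (h x - h (-x))) * (Real.exp (-b * x ^ 2) : ℂ) =
      x ^ (2 * κ) • (h x * (x * (Real.exp (-b * x ^ 2) : ℂ)) +
        h (-x) * ((-x : ℝ) * (Real.exp (-b * (-x) ^ 2) : ℂ))) := fun b x => by
    rw [Complex.real_smul, neg_sq]
    push_cast
    ring
  have hpos : ∀ x > 0, h x = 0 ∧ h (-x) = 0 := by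
    intro x hx
    have hadd := eq_zero_of_forall_integral_mul_exp_eq_zero
      (P := fun x => ((x ^ (2 * κ) : ℝ) : ℂ) * (h x + h (-x)))
      (hpow.mul (Continuous.continuousOn (by fun_prop)))
      (fun b hb => by
        simp only [e]
        exact integrableOn_Ioi_of_integrable_mu κ (hi b hb))
      (fun b hb => by
        simp only [e]
        rw [← integral_mu_eq_integral_Ioi κ (hi b hb), h0 b hb]) hx
    have hsub := eq_zero_of_forall_integral_mul_exp_eq_zero
      (P := fun x => ((x ^ (2 * κ) : ℝ) : ℂ) * (x * (h x - h (-x))))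
      (hpow.mul (Continuous.continuousOn (by fun_prop)))
      (fun b hb => by
        simp only [e']
        exact integrableOn_Ioi_of_integrable_mu κ (hi' b hb))
      (fun b hb => by
        simp only [e']
        rw [← integral_mu_eq_integral_Ioi κ (hi' b hb), h0' b hb]) hx
    have hx1 : ((x ^ (2 * κ) : ℝ) : ℂ) ≠ 0 := by exact_mod_cast (Real.rpow_pos_of_pos hx _).ne'
    have hx2 : (x : ℂ) ≠ 0 := by exact_mod_cast hx.ne'
    have ha := (mul_eq_zero.1 hadd).resolve_left hx1
    have hs := (mul_eq_zero.1 ((mul_eq_zero.1 hsub).resolve_left hx1)).resolve_left hx2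
    constructor
    · linear_combination (ha + hs) / 2
    · linear_combination (ha - hs) / 2
  refine hc.ext_on (dense_compl_singleton (0 : ℝ)) continuous_const fun x hx => ?_
  rcases lt_or_gt_of_ne (show x ≠ 0 from hx) with hx | hx
  · simpa using (hpos (-x) (neg_pos.2 hx)).2
  · exact (hpos x hx).1

lemma integral_dunkl_mul {κ : ℝ} (hκ : 0 < κ) (σ : ℝ) {f φ : ℝ → ℂ} (hf : Integrable f (mu κ))
    (hφ : Integrable φ (mu κ)) :
    ∫ y, ((ck κ : ℂ) * ∫ x, f x * dunklChar κ (σ * x * y) ∂(mu κ)) * φ y ∂(mu κ) =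
      ∫ x, f x * ((ck κ : ℂ) * ∫ y, φ y * dunklChar κ (σ * x * y) ∂(mu κ)) ∂(mu κ) := by
  obtain ⟨C, hC⟩ := exists_norm_dunklChar_le κ
  have hc := continuous_dunklChar hκ
  have hint : Integrable (Function.uncurry fun y x => φ y * f x * dunklChar κ (σ * x * y))
      ((mu κ).prod (mu κ)) :=
    (hφ.mul_prod hf).mul_bdd (c := C) (Continuous.aestronglyMeasurable (by fun_prop))
      (Eventually.of_forall fun p => hC _)
  have h1 : ∀ y, ((ck κ : ℂ) * ∫ x, f x * dunklChar κ (σ * x * y) ∂(mu κ)) * φ y =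
      (ck κ : ℂ) * ∫ x, φ y * f x * dunklChar κ (σ * x * y) ∂(mu κ) := fun y => by
    simp only [mul_assoc (φ y), integral_const_mul]
    ring
  have h2 : ∀ x, f x * ((ck κ : ℂ) * ∫ y, φ y * dunklChar κ (σ * x * y) ∂(mu κ)) =
      (ck κ : ℂ) * ∫ y, φ y * f x * dunklChar κ (σ * x * y) ∂(mu κ) := fun x => by
    simp only [mul_comm (φ _) (f x), mul_assoc (f x), integral_const_mul]
    ring
  simp only [h1, h2, integral_const_mul]
  rw [integral_integral_swap hint]

lemma dunkl_eq (κ : ℝ) (f : ℝ → ℂ) (y : ℝ) :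
    dunkl κ f y = (ck κ : ℂ) * ∫ x, f x * dunklChar κ (-1 * x * y) ∂(mu κ) := by
  simp only [dunkl, Ek_neg_I_mul]
  simp only [neg_mul, one_mul]

lemma inverse_dunkl_eq (κ : ℝ) (F : ℝ → ℂ) (x : ℝ) :
    (ck κ : ℂ) * ∫ y, F y * Ek κ x (Complex.I * y) ∂(mu κ) =
      (ck κ : ℂ) * ∫ y, F y * dunklChar κ (1 * y * x) ∂(mu κ) := by
  simp only [Ek_I_mul, one_mul, mul_comm x]

lemma continuous_inverse_dunkl {κ : ℝ} (hκ : 0 < κ) {F : ℝ → ℂ} (hF : Integrable F (mu κ)) :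
    Continuous fun x : ℝ => (ck κ : ℂ) * ∫ y, F y * Ek κ x (Complex.I * y) ∂(mu κ) := by
  obtain ⟨C, hC⟩ := exists_norm_dunklChar_le κ
  have hc := continuous_dunklChar hκ
  simp only [Ek_I_mul]
  refine continuous_const.mul (continuous_of_dominated
    (fun x => (integrable_mul_dunklChar hκ hF x).1)
    (fun x => Eventually.of_forall fun y => ?_) (hF.norm.mul_const C)
    (Eventually.of_forall fun y => by fun_prop))
  rw [norm_mul]
  exact mul_le_mul_of_nonneg_left (hC _) (norm_nonneg _)

lemma integrable_inverse_dunkl_mul {κ : ℝ} (hκ : 0 < κ) {F φ : ℝ → ℂ} (hF : Integrable F (mu κ))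
    (hφ : Integrable φ (mu κ)) :
    Integrable (fun x : ℝ =>
      ((ck κ : ℂ) * ∫ y, F y * Ek κ x (Complex.I * y) ∂(mu κ)) * φ x) (mu κ) := by
  obtain ⟨C, hC⟩ := exists_norm_dunklChar_le κ
  refine hφ.bdd_mul (c := ‖(ck κ : ℂ)‖ * ∫ y, ‖F y‖ * C ∂(mu κ))
    (continuous_inverse_dunkl hκ hF).aestronglyMeasurable (Eventually.of_forall fun x => ?_)
  rw [norm_mul]
  gcongr
  refine norm_integral_le_of_norm_le (hF.norm.mul_const C) (Eventually.of_forall fun y => ?_)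
  rw [norm_mul, Ek_I_mul]
  exact mul_le_mul_of_nonneg_left (hC _) (norm_nonneg _)

lemma integral_inverse_dunkl_dunkl_mul {κ : ℝ} (hκ : 0 < κ) {f φ ψ : ℝ → ℂ}
    (hf : Integrable f (mu κ)) (hft : Integrable (dunkl κ f) (mu κ))
    (hφ : Integrable φ (mu κ)) (hψ : Integrable ψ (mu κ)) {K K' : ℂ} (hK : K * K' = 1)
    (hφψ : ∀ t : ℝ, (ck κ : ℂ) * ∫ y, φ y * dunklChar κ (t * y) ∂(mu κ) = K * ψ t)
    (hψφ : ∀ t : ℝ, (ck κ : ℂ) * ∫ y, ψ y * dunklChar κ (-t * y) ∂(mu κ) = K' * φ t) :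
    ∫ x : ℝ, ((ck κ : ℂ) * ∫ y, dunkl κ f y * Ek κ x (Complex.I * y) ∂(mu κ)) * φ x ∂(mu κ) =
      ∫ x, f x * φ x ∂(mu κ) := by
  simp only [inverse_dunkl_eq]
  rw [integral_dunkl_mul hκ 1 hft hφ]
  simp only [one_mul, hφψ, mul_left_comm _ K, integral_const_mul]
  simp only [dunkl_eq]
  rw [integral_dunkl_mul hκ (-1) hf hψ]
  simp only [neg_mul, one_mul]
  simp only [← neg_mul, hψφ, mul_left_comm _ K', integral_const_mul]
  rw [← mul_assoc, mul_comm K', hK, one_mul]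

lemma norm_mul_exp_le {b : ℝ} (hb : 0 < b) {q : ℝ → ℂ} (hq : ∀ x, ‖q x‖ ≤ 1 + |x|) (x : ℝ) :
    ‖q x * (Real.exp (-b * x ^ 2) : ℂ)‖ ≤ 2 + 1 / b := by
  rw [norm_mul, Complex.norm_of_nonneg (Real.exp_pos _).le, neg_mul, Real.exp_neg,
    ← div_eq_mul_inv, div_le_iff₀ (Real.exp_pos _)]
  have h1 : |x| ≤ 1 + x ^ 2 := by nlinarith [sq_abs x, sq_nonneg (|x| - 1), abs_nonneg x]
  have h2 : b * x ^ 2 + 1 ≤ Real.exp (b * x ^ 2) := Real.add_one_le_exp _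
  calc ‖q x‖ ≤ 2 + x ^ 2 := by linarith [hq x]
    _ ≤ (2 + 1 / b) * (b * x ^ 2 + 1) := by
        have : (2 + 1 / b) * (b * x ^ 2 + 1) = 2 + x ^ 2 + (2 * (b * x ^ 2) + 1 / b) := by
          field_simp
          ring
        rw [this]
        have : 0 ≤ 2 * (b * x ^ 2) + 1 / b := by positivity
        linarith
    _ ≤ _ := by gcongr

lemma integrable_mul_mul_exp {κ b : ℝ} (hb : 0 < b) {f q : ℝ → ℂ} (hf : Integrable f (mu κ))
    (hqc : Continuous q) (hq : ∀ x, ‖q x‖ ≤ 1 + |x|) :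
    Integrable (fun x => f x * (q x * (Real.exp (-b * x ^ 2) : ℂ))) (mu κ) :=
  hf.mul_bdd (Continuous.aestronglyMeasurable (by fun_prop))
    (Eventually.of_forall (norm_mul_exp_le hb hq))

/-- inversion formula for the Dunkl transform. -/
theorem dunkl_inversion (κ : ℝ) (hκ : 0 < κ) (f : ℝ → ℂ)
    (hf1 : Integrable f (mu κ)) (hfc : Continuous f)
    (hft : Integrable (dunkl κ f) (mu κ)) :
    ∀ x : ℝ, f x = (ck κ : ℂ) *
      ∫ y, dunkl κ f y * Ek κ (x : ℂ) (Complex.I * (y : ℂ)) ∂(mu κ) := by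
  set g : ℝ → ℂ := fun x => (ck κ : ℂ) *
    ∫ y, dunkl κ f y * Ek κ (x : ℂ) (Complex.I * (y : ℂ)) ∂(mu κ) with hg
  have hgc : Continuous g := continuous_inverse_dunkl hκ hft
  have hone : ∀ b > 0, Integrable (fun x : ℝ => (Real.exp (-b * x ^ 2) : ℂ)) (mu κ) :=
    fun b hb => by
      simpa using integrable_mul_exp_mu hκ hb (q := fun _ => 1) continuous_const (by simp)
  have hid : ∀ b > 0, Integrable (fun x : ℝ => x * (Real.exp (-b * x ^ 2) : ℂ)) (mu κ) :=
    fun b hb => integrable_mul_exp_mu hκ hb (q := fun x => (x : ℂ)) (by fun_prop) (by simp)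
  have hfone : ∀ b > 0, Integrable (fun x => f x * (Real.exp (-b * x ^ 2) : ℂ)) (mu κ) :=
    fun b hb => by
      simpa using integrable_mul_mul_exp hb hf1 (q := fun _ => 1) continuous_const (by simp)
  have hfid : ∀ b > 0, Integrable (fun x => f x * (x * (Real.exp (-b * x ^ 2) : ℂ))) (mu κ) :=
    fun b hb => integrable_mul_mul_exp hb hf1 (q := fun x => (x : ℂ)) (by fun_prop) (by simp)
  have hgone := fun b hb => integrable_inverse_dunkl_mul hκ hft (hone b hb)
  have hgid := fun b hb => integrable_inverse_dunkl_mul hκ hft (hid b hb)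
  have hexp : ∀ b > 0, ∀ t : ℝ, Real.exp (-t ^ 2 / (4 * b)) = Real.exp (-(1 / (4 * b)) * t ^ 2) :=
    fun b _ t => by
      congr 1
      ring
  have hexp' : ∀ b > 0, ∀ t : ℝ,
      Real.exp (-(-t) ^ 2 / (4 * (1 / (4 * b)))) = Real.exp (-b * t ^ 2) := fun b hb t => by
    congr 1
    field_simp
  have hpow : ∀ b > 0, (2 * b : ℝ) ^ (-(κ + 1 / 2)) *
      (2 * (1 / (4 * b))) ^ (-(κ + 1 / 2)) = 1 := fun b hb => by
    rw [← Real.mul_rpow (by positivity) (by positivity),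
      show 2 * b * (2 * (1 / (4 * b))) = 1 by field_simp; norm_num, Real.one_rpow]
  have h := eq_zero_of_forall_integral_mu_eq_zero κ (h := fun x => f x - g x) (hfc.sub hgc)
    (fun b hb => by
      simp only [sub_mul]
      exact (hfone b hb).sub (hgone b hb))
    (fun b hb => by
      simp only [sub_mul]
      exact (hfid b hb).sub (hgid b hb))
    (fun b hb => by
      have hb' : 0 < 1 / (4 * b) := by positivity
      simp only [sub_mul]
      rw [integral_sub (hfone b hb) (hgone b hb), sub_eq_zero]
      refine (integral_inverse_dunkl_dunkl_mul hκ hf1 hft (hone b hb) (hone _ hb')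
        (K := ((2 * b) ^ (-(κ + 1 / 2)) : ℝ)) (K' := ((2 * (1 / (4 * b))) ^ (-(κ + 1 / 2)) : ℝ))
        (by exact_mod_cast hpow b hb) (fun t => ?_) (fun t => ?_)).symm
      · rw [dunkl_gaussian hκ hb, hexp b hb]
      · rw [dunkl_gaussian hκ hb', hexp' b hb])
    (fun b hb => by
      have hb' : 0 < 1 / (4 * b) := by positivity
      simp only [sub_mul]
      rw [integral_sub (hfid b hb) (hgid b hb), sub_eq_zero]
      refine (integral_inverse_dunkl_dunkl_mul hκ hf1 hft (hid b hb) (hid _ hb')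
        (K := Complex.I / (2 * b) * ((2 * b) ^ (-(κ + 1 / 2)) : ℝ))
        (K' := -(Complex.I / (2 * (1 / (4 * b) : ℝ)) *
          ((2 * (1 / (4 * b))) ^ (-(κ + 1 / 2)) : ℝ)))
        ?_ (fun t => ?_) (fun t => ?_)).symm
      · have h1 : (((2 * b : ℝ) ^ (-(κ + 1 / 2)) : ℝ) : ℂ) *
            (((2 * (1 / (4 * b))) ^ (-(κ + 1 / 2)) : ℝ) : ℂ) = 1 := by
          exact_mod_cast hpow b hb
        have h2 : Complex.I / (2 * b) * (Complex.I / (2 * (1 / (4 * b) : ℝ))) = -1 := by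
          have hbc : (b : ℂ) ≠ 0 := by exact_mod_cast hb.ne'
          push_cast
          field_simp
          rw [Complex.I_sq]
          norm_num
        linear_combination
          (-(Complex.I / (2 * b) * (Complex.I / (2 * (1 / (4 * b) : ℝ))))) * h1 - h2
      · rw [dunkl_mul_gaussian hκ hb, hexp b hb]
      · rw [dunkl_mul_gaussian hκ hb', hexp' b hb]
        push_cast
        ring)
  intro x
  exact sub_eq_zero.1 (congrFun h x)
end
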